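/- arXiv:2501.05049 — 3 statements merged into one kernel-verified Lean document; each statement's English description precedes it below -/
import Mathlib

section
/- For every integer n ≥ 5, the boxicity of the Kneser graph KG(n,2) equals n − 2. -/
/-- An assignment of axis-parallel boxes in `ℝ^d` (given coordinate-wise, as `d` nonempty closed
intervals per vertex) representing the graph `G`: two distinct vertices are adjacent iff their
boxes intersect, i.e. iff the intervals intersect in every coordinate. -/
def SimpleGraph.IsBoxRep {V : Type*} (G : SimpleGraph V) (d : ℕ) (I : V → Fin d → Set ℝ) : Prop :=
  (∀ v i, ∃ a b : ℝ, a ≤ b ∧ I v i = Set.Icc a b) ∧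
  ∀ u v : V, u ≠ v → (G.Adj u v ↔ ∀ i, (I u i ∩ I v i).Nonempty)

/-- The boxicity of a graph: the least dimension `d` such that `G` has a representation by
axis-parallel boxes in `ℝ^d`. -/
noncomputable def SimpleGraph.boxicity {V : Type*} (G : SimpleGraph V) : ℕ :=
  sInf {d : ℕ | ∃ I : V → Fin d → Set ℝ, G.IsBoxRep d I}

/-- `G` is an interval graph: its vertices can be assigned nonempty closed real intervals so that
two distinct vertices are adjacent iff their intervals intersect. -/
def SimpleGraph.IsIntervalGraph {V : Type*} (G : SimpleGraph V) : Prop :=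
  ∃ I : V → Set ℝ, (∀ v, ∃ a b : ℝ, a ≤ b ∧ I v = Set.Icc a b) ∧
    ∀ u v : V, u ≠ v → (G.Adj u v ↔ (I u ∩ I v).Nonempty)

/-- An interval-order graph is the complement of an interval graph. -/
def SimpleGraph.IsIntervalOrderGraph {V : Type*} (G : SimpleGraph V) : Prop :=
  Gᶜ.IsIntervalGraph

/-- The Kneser graph `KG(n,k)`: vertices are the `k`-element subsets of `{1,…,n}`,
two of them adjacent iff they are disjoint. -/
def kneserGraph (n k : ℕ) : SimpleGraph {s : Finset (Fin n) // s.card = k} :=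
  SimpleGraph.fromRel (fun a b => Disjoint a.1 b.1)

/-- A ternary relation `R v x y`, to be read as: the edge `vx` precedes the edge `vy` in an
interval order whose comparable edges always share an endpoint; `ab` is a first edge and
`ac` a last edge of that order. -/
structure CherryOrder {V : Type*} (R : V → V → V → Prop) (a b c : V) : Prop where
  ab : a ≠ b
  ac : a ≠ c
  bc : b ≠ c
  ne : ∀ {v x y}, R v x y → v ≠ x ∧ v ≠ y ∧ x ≠ y
  clash : ∀ {v x y p q r}, R v x y → R p q r → v ≠ p →
    v = r ∨ x = p ∨ x = r ∨ p = y ∨ q = v ∨ q = y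
  trans : ∀ {v x y z}, R v x y → R y v z → x = z
  first : ∀ {v x y}, R v x y → v = a ∨ v = b ∨ y = a ∨ y = b
  last : ∀ {v x y}, R v x y → v = a ∨ v = c ∨ x = a ∨ x = c

namespace CherryOrder

variable {V : Type*} {R : V → V → V → Prop} {a b c : V}

lemma reverse (h : CherryOrder R a b c) : CherryOrder (fun v x y => R v y x) a c b where
  ab := h.ac
  ac := h.ab
  bc := h.bc.symm
  ne := fun H => by have := h.ne H; grind
  clash := fun H₁ H₂ hvp => by have := h.clash H₁ H₂ hvp; grind
  trans := fun {v x y z} H₁ H₂ => by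
    by_contra hne
    have := h.trans H₂ H₁
    grind (splits := 30)
  first := fun H => h.last H
  last := fun H => h.first H

lemma shape (h : CherryOrder R a b c) {v x y : V} (H : R v x y) :
    v = a ∨ (v = b ∧ (x = a ∨ y = a ∨ x = c)) ∨ (v = c ∧ (x = a ∨ y = a ∨ y = b)) ∨
      (x = a ∧ y = b) ∨ (x = c ∧ y = a) ∨ (x = c ∧ y = b) := by
  have h1 := h.first H
  have h2 := h.last H
  have h3 := h.ne H
  have h4 := h.bc
  grind (splits := 30)

/-- A set of cherries `x - v - y` is contained in the union of the stars `S` (given by centre and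
one leaf) and the single cherries `P`. -/
def CoveredBy (R : V → V → V → Prop) (S : List (V × V)) (P : List (V × V × V)) : Prop :=
  ∀ v x y, R v x y → (v, x) ∈ S ∨ (v, y) ∈ S ∨ (v, x, y) ∈ P ∨ (v, y, x) ∈ P

/-- A cover by five stars and three cherries, or by four stars and five cherries. -/
def SmallCover (R : V → V → V → Prop) : Prop :=
  ∃ S P, CoveredBy R S P ∧
    (S.length ≤ 5 ∧ P.length ≤ 3 ∨ S.length ≤ 4 ∧ P.length ≤ 5)

lemma SmallCover.of_reverse (h : SmallCover (fun v x y => R v y x)) : SmallCover R := by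
  obtain ⟨S, P, hc, hl⟩ := h
  refine ⟨S, P, fun v x y H => ?_, hl⟩
  have := hc v y x H
  tauto

lemma exists_index {p : V → Prop} (hp : ∀ x y, p x → p y → x = y) (d : V) :
    ∃ e, ∀ x, p x → x = e := by
  by_cases h : ∃ x, p x
  · obtain ⟨e, he⟩ := h
    exact ⟨e, fun x hx => hp x e hx he⟩
  · exact ⟨d, fun x hx => (h ⟨x, hx⟩).elim⟩

lemma eq_of_right (h : CherryOrder R a b c) {x y : V} (hx : R x a b) (hy : R y a b) : x = y := by
  by_contra hne
  have := h.clash hx hy hne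
  have := h.ne hx
  have := h.ne hy
  grind (splits := 30)

lemma eq_of_mid (h : CherryOrder R a b c) {x y : V} (hx : R x c b) (hy : R y c b) : x = y := by
  by_contra hne
  have := h.clash hx hy hne
  have := h.ne hx
  have := h.ne hy
  grind (splits := 30)

/-- The clash of two comparabilities with different centres, packaged with the distinctness
of the vertices involved. -/
lemma clash' (h : CherryOrder R a b c) {v x y p q r : V} (h₁ : R v x y) (h₂ : R p q r) :
    (v = p ∨ v = r ∨ x = p ∨ x = r ∨ p = y ∨ q = v ∨ q = y) ∧
      (p = y → q = v → x = r) ∧ (p = x → r = v → q = y) ∧ (v ≠ x ∧ v ≠ y ∧ x ≠ y) ∧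
      (p ≠ q ∧ p ≠ r ∧ q ≠ r) ∧ a ≠ b ∧ a ≠ c ∧ b ≠ c := by
  refine ⟨?_, ?_, ?_, h.ne h₁, h.ne h₂, h.ab, h.ac, h.bc⟩
  · by_cases hvp : v = p
    · exact Or.inl hvp
    · exact Or.inr (h.clash h₁ h₂ hvp)
  · rintro rfl rfl
    exact h.trans h₁ h₂
  · rintro rfl rfl
    exact h.trans h₂ h₁

lemma smallCover_of_two (h : CherryOrder R a b c) {d e : V} (hd : R b c d) (he : R b c e)
    (hda : d ≠ a) (hea : e ≠ a) (hde : d ≠ e) : SmallCover R := by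
  obtain ⟨p, hp⟩ := exists_index (p := fun x => R x a b) (fun x y => h.eq_of_right) a
  obtain ⟨q, hq⟩ := exists_index (p := fun x => R x c b) (fun x y => h.eq_of_mid) a
  refine ⟨[(a, b), (a, c), (b, a), (b, c), (c, a)], [(p, a, b), (q, c, b)], ?_,
    Or.inl ⟨by simp, by simp⟩⟩
  intro v x y H
  have h0 := h.shape H
  have h1 := h.clash' H hd
  have h2 := h.clash' H he
  have h3 := hp v
  have h4 := hq v
  simp only [List.mem_cons, Prod.mk.injEq, List.not_mem_nil, or_false]
  grind (splits := 30)

lemma smallCover_of_split (h : CherryOrder R a b c) {d e : V} (hd : R b c d) (he : R e c b)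
    (hda : d ≠ a) (hea : e ≠ a) (hde : d ≠ e) (hu : ∀ x, R b c x → x ≠ a → x = d) :
    SmallCover R := by
  refine ⟨[(a, b), (a, c), (b, a), (c, a)],
    [(b, c, d), (c, d, b), (e, c, b), (a, d, e), (e, a, b)], ?_, Or.inr ⟨by simp, by simp⟩⟩
  intro v x y H
  have h0 := h.shape H
  have h1 := h.clash' H hd
  have h2 := h.clash' H he
  have h3 := hu y
  simp only [List.mem_cons, Prod.mk.injEq, List.not_mem_nil, or_false]
  grind (splits := 30)

lemma smallCover_of_left (h : CherryOrder R a b c) {d z : V}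
    (hC : ∀ x, R b c x → x ≠ a → x = d) (hF : ∀ x, R x c b → x ≠ a → x = d)
    (hD : ∀ x, R c x b → x ≠ a → x = d)
    (hex : R b c d ∨ R d c b ∨ R c d b) (hda : d ≠ a) (hz : R a d z) (hzb : z ≠ b) (hzc : z ≠ c) :
    SmallCover R := by
  obtain ⟨p, hp⟩ := exists_index (p := fun x => R x a b) (fun x y => h.eq_of_right) a
  refine ⟨[(a, b), (a, c), (a, d), (b, a), (c, a)],
    [(p, a, b), (b, c, d), (d, c, b)], ?_, Or.inl ⟨by simp, by simp⟩⟩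
  have hN : ¬ R c d b := by
    intro H
    have := h.clash' H hz
    grind (splits := 30)
  have hex' : R b c d ∨ R d c b := by tauto
  intro v x y H
  have h0 := h.shape H
  have h1 := h.clash' H hz
  have h3 := hC y
  have h4 := hF v
  have h5 := hp v
  have h6 := hD x
  simp only [List.mem_cons, Prod.mk.injEq, List.not_mem_nil, or_false]
  rcases hex' with hh | hh
  · have h2 := h.clash' H hh
    grind (splits := 30)
  · have h2 := h.clash' H hh
    grind (splits := 30)

lemma smallCover_of_unique (h : CherryOrder R a b c) {d : V}
    (hC : ∀ x, R b c x → x ≠ a → x = d) (hF : ∀ x, R x c b → x ≠ a → x = d)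
    (hD : ∀ x, R c x b → x ≠ a → x = d)
    (hex : R b c d ∨ R d c b ∨ R c d b) (hda : d ≠ a) :
    SmallCover R := by
  by_cases hl : ∃ z, R a d z ∧ z ≠ b ∧ z ≠ c
  · obtain ⟨z, hz, hzb, hzc⟩ := hl
    exact h.smallCover_of_left hC hF hD hex hda hz hzb hzc
  by_cases hr : ∃ z, R a z d ∧ z ≠ b ∧ z ≠ c
  · obtain ⟨z, hz, hzb, hzc⟩ := hr
    exact (h.reverse.smallCover_of_left hD hF hC (by tauto) hda hz hzc hzb).of_reverse
  obtain ⟨p, hp⟩ := exists_index (p := fun x => R x a b) (fun x y => h.eq_of_right) a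
  obtain ⟨q, hq⟩ := exists_index (p := fun x => R x c a) (fun x y => h.reverse.eq_of_right) a
  refine ⟨[(a, b), (a, c), (b, a), (c, a)],
    [(p, a, b), (q, c, a), (b, c, d), (c, d, b), (d, c, b)], ?_, Or.inr ⟨by simp, by simp⟩⟩
  push Not at hl hr
  intro v x y H
  have h0 := h.shape H
  have h1 := hC y
  have h2 := hF v
  have h3 := hD x
  have h4 := hp v
  have h5 := hq v
  have h6 := hl y
  have h7 := hr x
  simp only [List.mem_cons, Prod.mk.injEq, List.not_mem_nil, or_false]
  rcases hex with hh | hh | hh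
  all_goals
    have h8 := h.clash' H hh
    clear hC hF hD hp hq hl hr
    rcases h0 with rfl | ⟨rfl, h0⟩ | ⟨rfl, h0⟩ | ⟨rfl, rfl⟩ | ⟨rfl, rfl⟩ | ⟨rfl, rfl⟩ <;>
      grind (splits := 30)

/-- An order comparing two edges that avoid the common vertex `a` of its first and last edge is
covered by few stars and cherries. -/
lemma smallCover (h : CherryOrder R a b c) {v x y : V} (H : R v x y) (hv : v ≠ a) (hx : x ≠ a)
    (hy : y ≠ a) : SmallCover R := by
  by_cases h2 : ∃ d e, R b c d ∧ R b c e ∧ d ≠ a ∧ e ≠ a ∧ d ≠ e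
  · obtain ⟨d, e, hd, he, hda, hea, hde⟩ := h2
    exact h.smallCover_of_two hd he hda hea hde
  by_cases h3 : ∃ d e, R c d b ∧ R c e b ∧ d ≠ a ∧ e ≠ a ∧ d ≠ e
  · obtain ⟨d, e, hd, he, hda, hea, hde⟩ := h3
    exact (h.reverse.smallCover_of_two hd he hda hea hde).of_reverse
  push Not at h2 h3
  by_cases h4 : ∃ d e, R b c d ∧ R e c b ∧ d ≠ a ∧ e ≠ a ∧ d ≠ e
  · obtain ⟨d, e, hd, he, hda, hea, hde⟩ := h4
    exact h.smallCover_of_split hd he hda hea hde fun x hx hxa => h2 x d hx hd hxa hda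
  by_cases h5 : ∃ d e, R c d b ∧ R e c b ∧ d ≠ a ∧ e ≠ a ∧ d ≠ e
  · obtain ⟨d, e, hd, he, hda, hea, hde⟩ := h5
    exact (h.reverse.smallCover_of_split hd he hda hea hde
      fun x hx hxa => h3 x d hx hd hxa hda).of_reverse
  push Not at h4 h5
  have hCD : ∀ d e, R b c d → R c e b → d ≠ a → e ≠ a → d = e := by
    intro d e hd he hda hea
    have := h.clash' hd he
    grind (splits := 30)
  obtain ⟨d, hda, hex⟩ : ∃ d, d ≠ a ∧ (R b c d ∨ R d c b ∨ R c d b) := by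
    have := h.shape H
    grind (splits := 30)
  refine h.smallCover_of_unique (d := d) ?_ ?_ ?_ hex hda
  all_goals
    intro z hz hza
    have := fun x y => h.eq_of_mid (x := x) (y := y)
    grind (splits := 30)

end CherryOrder

namespace CherryOrder

variable {V : Type*} {R R' : V → V → V → Prop} {a b c a' b' c' : V}

lemma shape_of_ne (h : CherryOrder R a b c) {v x y : V} (H : R v x y) (hv : v ≠ a) (hx : x ≠ a)
    (hy : y ≠ a) : (v = b ∧ x = c) ∨ (v = c ∧ y = b) ∨ (x = c ∧ y = b) := by
  have := h.shape H
  tauto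

/-- `R` and `R'` together compare the two edges of every cherry in `W`. -/
def Covers (W : Finset V) (R R' : V → V → V → Prop) : Prop :=
  ∀ v ∈ W, ∀ x ∈ W, ∀ y ∈ W, v ≠ x → v ≠ y → x ≠ y →
    (R v x y ∨ R v y x) ∨ (R' v x y ∨ R' v y x)

lemma not_covers_of_same_center (h : CherryOrder R a b c) (h' : CherryOrder R' a b' c')
    {p q : V} {W : Finset V} (hcov : Covers W R R') (hb : b ∈ W) (hc : c ∈ W)
    (hp : p ∈ W) (hq : q ∈ W) (hpa : p ≠ a) (hqa : q ≠ a) (hpb : p ≠ b) (hpc : p ≠ c)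
    (hqb : q ≠ b) (hqc : q ≠ c) (hpq : p ≠ q) : False := by
  have hab := h.ab
  have hac := h.ac
  have hbc := h.bc
  have hbc' := h'.bc
  have key : ∀ {v x y}, R v x y ∨ R v y x → v ≠ a → x ≠ a → y ≠ a →
      (b = v ∨ b = x ∨ b = y) ∧ (c = v ∨ c = x ∨ c = y) := by
    rintro v x y (H | H) hv hx hy
    · have := h.shape_of_ne H hv hx hy
      grind
    · have := h.shape_of_ne H hv hy hx
      grind
  have key' : ∀ {v x y}, R' v x y ∨ R' v y x → v ≠ a → x ≠ a → y ≠ a →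
      (b' = v ∨ b' = x ∨ b' = y) ∧ (c' = v ∨ c' = x ∨ c' = y) := by
    rintro v x y (H | H) hv hx hy
    · have := h'.shape_of_ne H hv hx hy
      grind
    · have := h'.shape_of_ne H hv hy hx
      grind
  have e₁ : (b' = p ∨ b' = b ∨ b' = q) ∧ (c' = p ∨ c' = b ∨ c' = q) := by
    rcases hcov p hp b hb q hq hpb hpq hqb.symm with H | H
    · have := key H hpa hab.symm hqa
      grind
    · exact key' H hpa hab.symm hqa
  have e₂ : (b' = p ∨ b' = c ∨ b' = q) ∧ (c' = p ∨ c' = c ∨ c' = q) := by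
    rcases hcov p hp c hc q hq hpc hpq hqc.symm with H | H
    · have := key H hpa hac.symm hqa
      grind
    · exact key' H hpa hac.symm hqa
  have hD : R c p b := by
    rcases hcov c hc p hp b hb hpc.symm hbc.symm hpb with (H | H) | H
    · exact H
    · have := h.shape_of_ne H hac.symm hab.symm hpa
      grind
    · have := key' H hac.symm hpa hab.symm
      grind
  have hC : R b c q := by
    rcases hcov b hb c hc q hq hbc hqb.symm hqc.symm with (H | H) | H
    · exact H
    · have := h.shape_of_ne H hab.symm hqa hac.symm
      grind
    · have := key' H hab.symm hac.symm hqa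
      grind
  have := h.clash' hD hC
  grind

lemma not_covers_of_path {s t d : V} (h : CherryOrder R a s t) (h' : CherryOrder R' a' d t)
    {W : Finset V} (hcov : Covers W R R') (ha : a ∈ W) (ha' : a' ∈ W) (hs : s ∈ W) (ht : t ∈ W)
    (hd : d ∈ W) (haa' : a ≠ a') (hda : d ≠ a) (hsa' : s ≠ a') (hsd : s ≠ d) : False := by
  have n₁ := h.ab
  have n₂ := h.ac
  have n₃ := h.bc
  have n₄ := h'.ab
  have n₅ := h'.ac
  have n₆ := h'.bc
  have k₁ : R' s a' d := by
    rcases hcov s hs a' ha' d hd hsa' hsd n₄ with (H | H) | (H | H)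
    · have := h.shape H
      grind
    · have := h.shape H
      grind
    · exact H
    · have := h'.shape H
      grind
  have k₂ : R d a s := by
    rcases hcov d hd a ha s hs hda hsd.symm n₁ with (H | H) | (H | H)
    · exact H
    · have := h.shape H
      grind
    · have := h'.shape H
      grind
    · have := h'.shape H
      grind
  have k₃ : R a d a' := by
    rcases hcov a ha d hd a' ha' hda.symm haa' n₄.symm with (H | H) | (H | H)
    · exact H
    · exact absurd (h.trans H k₂) hsa'.symm
    · have := h'.shape H
      grind
    · have := h'.clash' H k₁
      grind
  have k₄ : R' a' s a := by
    rcases hcov a' ha' s hs a ha hsa'.symm haa'.symm n₁.symm with (H | H) | (H | H)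
    · have := h.shape H
      grind
    · have := h.clash' H k₂
      grind
    · exact H
    · exact absurd (h'.trans H k₁) hda.symm
  rcases hcov t ht s hs d hd n₃.symm n₆.symm hsd with (H | H) | (H | H)
  · have := h.shape H
    grind
  · have := h.clash' H k₃
    grind
  · have := h'.clash' H k₄
    grind
  · have := h'.shape H
    grind

lemma Covers.reverse_left {W : Finset V} (h : Covers W R R') :
    Covers W (fun v x y => R v y x) R' := by
  intro v hv x hx y hy h₁ h₂ h₃
  have := h v hv x hx y hy h₁ h₂ h₃
  tauto

lemma Covers.symm {W : Finset V} (h : Covers W R R') : Covers W R' R := by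
  intro v hv x hx y hy h₁ h₂ h₃
  have := h v hv x hx y hy h₁ h₂ h₃
  tauto

lemma Covers.reverse_right {W : Finset V} (h : Covers W R R') :
    Covers W R (fun v x y => R' v y x) :=
  h.symm.reverse_left.symm

lemma not_covers_of_touch {s t d : V} (h : CherryOrder R a s t) (h' : CherryOrder R' a' b' c')
    {W : Finset V} (hcov : Covers W R R') (ha : a ∈ W) (ha' : a' ∈ W) (hs : s ∈ W) (ht : t ∈ W)
    (hd : d ∈ W) (haa' : a ≠ a') (hda : d ≠ a) (hda' : d ≠ a') (hsa' : s ≠ a') (hta' : t ≠ a')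
    (hsd : s ≠ d) (htd : t ≠ d) : False := by
  have n₁ := h.ab
  have n₂ := h.ac
  have n₃ := h.bc
  have n₄ := h'.ab
  have n₅ := h'.ac
  have n₆ := h'.bc
  have hs' : R' s a' d ∨ R' s d a' := by
    refine (hcov s hs a' ha' d hd hsa' hsd hda'.symm).resolve_left ?_
    rintro (H | H) <;> have := h.shape H <;> grind
  have ht' : R' t a' d ∨ R' t d a' := by
    refine (hcov t ht a' ha' d hd hta' htd hda'.symm).resolve_left ?_
    rintro (H | H) <;> have := h.shape H <;> grind
  have hs'' : (s = b' ∨ s = c') ∨ (d = b' ∧ R' s a' b') ∨ (d = c' ∧ R' s c' a') := by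
    rcases hs' with H | H <;> have := h'.shape H <;> grind
  have ht'' : (t = b' ∨ t = c') ∨ (d = b' ∧ R' t a' b') ∨ (d = c' ∧ R' t c' a') := by
    rcases ht' with H | H <;> have := h'.shape H <;> grind
  rcases hs'' with hs'' | hs''
  · rcases ht'' with ht'' | ht''
    · rcases hcov d hd a ha a' ha' hda hda' haa' with (H | H) | (H | H)
      · have := h.shape H
        grind
      · have := h.shape H
        grind
      · have := h'.shape H
        grind
      · have := h'.shape H
        grind
    · rcases hs'' with rfl | rfl
      · obtain rfl : d = c' := by grind
        exact not_covers_of_path h.reverse h'.reverse hcov.reverse_left.reverse_right ha ha' ht hs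
          hd haa' hda hta' htd
      · obtain rfl : d = b' := by grind
        exact not_covers_of_path h.reverse h' hcov.reverse_left ha ha' ht hs
          hd haa' hda hta' htd
  · rcases ht'' with ht'' | ht''
    · rcases ht'' with rfl | rfl
      · obtain rfl : d = c' := by grind
        exact not_covers_of_path h h'.reverse hcov.reverse_right ha ha' hs ht
          hd haa' hda hsa' hsd
      · obtain rfl : d = b' := by grind
        exact not_covers_of_path h h' hcov ha ha' hs ht hd haa' hda hsa' hsd
    · rcases hs'' with ⟨rfl, H⟩ | ⟨rfl, H⟩ <;> rcases ht'' with ⟨e, H'⟩ | ⟨e, H'⟩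
      · exact n₃ (h'.eq_of_right H H')
      · exact n₆ e
      · exact n₆ e.symm
      · exact n₃ (h'.reverse.eq_of_right H H')

/-- Two interval orders do not suffice to cover the cherries on five vertices. -/
lemma not_covers_of_card_eq_five [DecidableEq V] (h : CherryOrder R a b c)
    (h' : CherryOrder R' a' b' c') {W : Finset V} (hW : W.card = 5) (ha : a ∈ W) (hb : b ∈ W)
    (hc : c ∈ W) (ha' : a' ∈ W) (hb' : b' ∈ W) (hc' : c' ∈ W) : ¬ Covers W R R' := by
  intro hcov
  by_cases haa' : a = a'
  · subst haa'
    have hcard : 1 < (W \ {a, b, c}).card := by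
      have := Finset.le_card_sdiff ({a, b, c} : Finset V) W
      have := Finset.card_le_three (a := a) (b := b) (c := c)
      omega
    obtain ⟨p, hp, q, hq, hpq⟩ := Finset.one_lt_card.mp hcard
    simp only [Finset.mem_sdiff, Finset.mem_insert, Finset.mem_singleton, not_or] at hp hq
    exact not_covers_of_same_center h h' hcov hb hc hp.1 hq.1 hp.2.1 hq.2.1 hp.2.2.1 hp.2.2.2
      hq.2.2.1 hq.2.2.2 hpq
  · have hcard : 2 < (W \ {a, a'}).card := by
      have := Finset.le_card_sdiff ({a, a'} : Finset V) W
      have := Finset.card_le_two (a := a) (b := a')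
      omega
    obtain ⟨x, hx, y, hy, z, hz, hxy, hxz, hyz⟩ := Finset.two_lt_card.mp hcard
    simp only [Finset.mem_sdiff, Finset.mem_insert, Finset.mem_singleton, not_or] at hx hy hz
    have touch : ∀ {v x y}, R v x y → v ∈ W → x ∈ W → y ∈ W → v ≠ a → x ≠ a → y ≠ a → v ≠ a' →
        x ≠ a' → y ≠ a' → False := by
      intro v x y H hvW hxW hyW hv hx hy hv' hx' hy'
      have hne := h.ne H
      rcases h.shape_of_ne H hv hx hy with ⟨rfl, rfl⟩ | ⟨rfl, rfl⟩ | ⟨rfl, rfl⟩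
      · exact not_covers_of_touch h h' hcov ha ha' hb hc hyW haa' hy hy' hv' hx' hne.2.1 hne.2.2
      · exact not_covers_of_touch h h' hcov ha ha' hb hc hxW haa' hx hx' hy' hv' hne.2.2.symm
          hne.1
      · exact not_covers_of_touch h h' hcov ha ha' hb hc hvW haa' hv hv' hy' hx' hne.2.1.symm
          hne.1.symm
    have touch' : ∀ {v x y}, R' v x y → v ∈ W → x ∈ W → y ∈ W → v ≠ a → x ≠ a → y ≠ a → v ≠ a' →
        x ≠ a' → y ≠ a' → False := by
      intro v x y H hvW hxW hyW hv hx hy hv' hx' hy'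
      have hne := h'.ne H
      rcases h'.shape_of_ne H hv' hx' hy' with ⟨rfl, rfl⟩ | ⟨rfl, rfl⟩ | ⟨rfl, rfl⟩
      · exact not_covers_of_touch h' h hcov.symm ha' ha hb' hc' hyW (Ne.symm haa') hy' hy hv hx
          hne.2.1 hne.2.2
      · exact not_covers_of_touch h' h hcov.symm ha' ha hb' hc' hxW (Ne.symm haa') hx' hx hy hv
          hne.2.2.symm hne.1
      · exact not_covers_of_touch h' h hcov.symm ha' ha hb' hc' hvW (Ne.symm haa') hv' hv hy hx
          hne.2.1.symm hne.1.symm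
    obtain ⟨hxW, hxa, hxa'⟩ := hx
    obtain ⟨hyW, hya, hya'⟩ := hy
    obtain ⟨hzW, hza, hza'⟩ := hz
    rcases hcov x hxW y hyW z hzW hxy hxz hyz with (H | H) | (H | H)
    · exact touch H hxW hyW hzW hxa hya hza hxa' hya' hza'
    · exact touch H hxW hzW hyW hxa hza hya hxa' hza' hya'
    · exact touch' H hxW hyW hzW hxa hya hza hxa' hya' hza'
    · exact touch' H hxW hzW hyW hxa hza hya hxa' hza' hya'

end CherryOrder

/-- For each edge of the complete graph on `V`, a pair of reals meant as the endpoints of an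
interval. -/
structure IntervalFamily (V : Type*) where
  lo : Sym2 V → ℝ
  hi : Sym2 V → ℝ
  le : ∀ e, lo e ≤ hi e

namespace IntervalFamily

variable {V : Type*} {J : IntervalFamily V} {W : Finset V}

/-- Inside `W`, the interval of `vx` lies entirely to the left of that of `vy`. -/
def Before (J : IntervalFamily V) (W : Finset V) (v x y : V) : Prop :=
  v ∈ W ∧ x ∈ W ∧ y ∈ W ∧ v ≠ x ∧ v ≠ y ∧ x ≠ y ∧ J.hi s(v, x) < J.lo s(v, y)

/-- Inside `W`, intervals of disjoint edges intersect. -/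
def IsLocal (J : IntervalFamily V) (W : Finset V) : Prop :=
  ∀ x ∈ W, ∀ y ∈ W, ∀ z ∈ W, ∀ w ∈ W, x ≠ y → z ≠ w → J.hi s(x, y) < J.lo s(z, w) →
    x = z ∨ x = w ∨ y = z ∨ y = w

lemma IsLocal.mono {W' : Finset V} (h : J.IsLocal W) (hs : W' ⊆ W) : J.IsLocal W' :=
  fun x hx y hy z hz w hw => h x (hs hx) y (hs hy) z (hs hz) w (hs hw)

lemma Before.congr_of_mem {W' : Finset V} {v x y : V} (h : J.Before W v x y) (hv : v ∈ W')
    (hx : x ∈ W') (hy : y ∈ W') : J.Before W' v x y :=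
  ⟨hv, hx, hy, h.2.2.2⟩

/-- The order of the intervals inside `W`, seen from an edge `ab` of minimal right end and an
edge `ac` of maximal left end. -/
lemma IsLocal.cherryOrder (h : J.IsLocal W) {a b c : V} (ha : a ∈ W) (hb : b ∈ W) (hc : c ∈ W)
    (hab : a ≠ b) (hac : a ≠ c) (hbc : b ≠ c)
    (hmin : ∀ v ∈ W, ∀ y ∈ W, v ≠ y → J.hi s(a, b) ≤ J.hi s(v, y))
    (hmax : ∀ v ∈ W, ∀ y ∈ W, v ≠ y → J.lo s(v, y) ≤ J.lo s(a, c)) :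
    CherryOrder (J.Before W) a b c where
  ab := hab
  ac := hac
  bc := hbc
  ne := fun H => ⟨H.2.2.2.1, H.2.2.2.2.1, H.2.2.2.2.2.1⟩
  clash := by
    rintro v x y p q r ⟨hv, hx, hy, hvx, hvy, hxy, H⟩ ⟨hp, hq, hr, hpq, hpr, hqr, H'⟩ hvp
    rcases lt_or_ge (J.hi s(v, x)) (J.lo s(p, r)) with h1 | h1
    · have := h v hv x hx p hp r hr hvx hpr h1
      tauto
    · have := h p hp q hq v hv y hy hpq hvy (by linarith)
      have := hvp.symm
      tauto
  trans := by
    rintro v x y z ⟨hv, hx, hy, hvx, hvy, hxy, H⟩ ⟨-, -, hz, hyv, hyz, hvz, H'⟩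
    have h1 := J.le s(v, y)
    rw [Sym2.eq_swap] at H'
    have := h v hv x hx y hy z hz hvx hyz (by linarith)
    tauto
  first := by
    rintro v x y ⟨hv, hx, hy, hvx, hvy, hxy, H⟩
    have := h a ha b hb v hv y hy hab hvy ((hmin v hv x hx hvx).trans_lt H)
    grind
  last := by
    rintro v x y ⟨hv, hx, hy, hvx, hvy, hxy, H⟩
    have := h v hv x hx a ha c hc hvx hac (H.trans_le (hmax v hv y hy hvy))
    grind

lemma IsLocal.exists_cherryOrder [DecidableEq V] (h : J.IsLocal W) (hW : 2 < W.card) :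
    ∃ a ∈ W, ∃ b ∈ W, ∃ c ∈ W, CherryOrder (J.Before W) a b c := by
  obtain ⟨p, hp, q, hq, r, hr, hpq, hpr, hqr⟩ := Finset.two_lt_card.mp hW
  by_cases hR : ∃ v x y, J.Before W v x y
  · obtain ⟨v, x, y, hv, hx, hy, hvx, hvy, hxy, H⟩ := hR
    have hne : W.offDiag.Nonempty := ⟨(p, q), by simp [hp, hq, hpq]⟩
    obtain ⟨e, he, hmin⟩ := W.offDiag.exists_min_image (fun e => J.hi s(e.1, e.2)) hne
    obtain ⟨f, hf, hmax⟩ := W.offDiag.exists_max_image (fun e => J.lo s(e.1, e.2)) hne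
    obtain ⟨a, b⟩ := e
    obtain ⟨c, d⟩ := f
    simp only [Finset.mem_offDiag, Prod.forall, and_imp] at he hf hmin hmax
    obtain ⟨ha, hb, hab⟩ := he
    obtain ⟨hc, hd, hcd⟩ := hf
    have hlt : J.hi s(a, b) < J.lo s(c, d) :=
      ((hmin v x hv hx hvx).trans_lt H).trans_le (hmax v y hv hy hvy)
    have hef : s(a, b) ≠ s(c, d) := fun e => by
      rw [e] at hlt
      exact absurd (J.le s(c, d)) (not_le.mpr hlt)
    have hmin' : ∀ v ∈ W, ∀ y ∈ W, v ≠ y → J.hi s(b, a) ≤ J.hi s(v, y) := fun v hv y hy n => by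
      rw [Sym2.eq_swap]
      exact hmin v y hv hy n
    have hmax' : ∀ v ∈ W, ∀ y ∈ W, v ≠ y → J.lo s(v, y) ≤ J.lo s(d, c) := fun v hv y hy n => by
      rw [Sym2.eq_swap (a := d)]
      exact hmax v y hv hy n
    rcases h a ha b hb c hc d hd hab hcd hlt with rfl | rfl | rfl | rfl
    · exact ⟨a, ha, b, hb, d, hd, h.cherryOrder ha hb hd hab hcd (by grind)
        (fun v hv y hy n => hmin v y hv hy n) (fun v hv y hy n => hmax v y hv hy n)⟩
    · exact ⟨a, ha, b, hb, c, hc, h.cherryOrder ha hb hc hab hcd.symm (by grind [Sym2.eq_swap])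
        (fun v hv y hy n => hmin v y hv hy n) hmax'⟩
    · exact ⟨b, hb, a, ha, d, hd, h.cherryOrder hb ha hd hab.symm hcd (by grind [Sym2.eq_swap])
        hmin' (fun v hv y hy n => hmax v y hv hy n)⟩
    · exact ⟨b, hb, a, ha, c, hc, h.cherryOrder hb ha hc hab.symm hcd.symm (by grind)
        hmin' hmax'⟩
  · push Not at hR
    exact ⟨p, hp, q, hq, r, hr, ⟨hpq, hpr, hqr, fun H => (hR _ _ _ H).elim,
      fun H => (hR _ _ _ H).elim, fun H => (hR _ _ _ H).elim, fun H => (hR _ _ _ H).elim,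
      fun H => (hR _ _ _ H).elim⟩⟩

end IntervalFamily

section Counting

variable {V ι : Type*} [DecidableEq V]

lemma sum_card_mul_pred_le_two_mul_sum_length {W : Finset V} {I : Finset ι}
    {L : V → Finset V} {P : ι → List (V × V × V)}
    (hL : ∀ v ∈ W, ∀ x ∈ L v, ∀ y ∈ L v, x ≠ y → ∃ i ∈ I, (v, x, y) ∈ P i ∨ (v, y, x) ∈ P i) :
    ∑ v ∈ W, (L v).card * ((L v).card - 1) ≤ ∑ i ∈ I, 2 * (P i).length := by
  calc ∑ v ∈ W, (L v).card * ((L v).card - 1)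
      = (W.sigma fun v => (L v).offDiag).card := by
        rw [Finset.card_sigma]
        exact Finset.sum_congr rfl fun v _ => by rw [Finset.offDiag_card, Nat.mul_sub_one]
    _ ≤ (I.biUnion fun i =>
          (P i ++ (P i).map fun t => (t.1, t.2.2, t.2.1)).toFinset).card := by
        refine Finset.card_le_card_of_injOn (fun t => (t.1, t.2.1, t.2.2)) ?_ ?_
        · rintro ⟨v, x, y⟩ ht
          simp only [Finset.coe_sigma, Set.mem_sigma_iff, Finset.mem_coe,
            Finset.mem_offDiag] at ht
          obtain ⟨i, hi, hP⟩ := hL v ht.1 x ht.2.1 y ht.2.2.1 ht.2.2.2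
          simp only [Finset.coe_biUnion, Set.mem_iUnion, Finset.mem_coe, List.mem_toFinset,
            List.mem_append, List.mem_map]
          rcases hP with hP | hP
          · exact ⟨i, hi, Or.inl hP⟩
          · exact ⟨i, hi, Or.inr ⟨_, hP, rfl⟩⟩
        · rintro ⟨v, x, y⟩ _ ⟨v', x', y'⟩ _ h
          simp only [Prod.mk.injEq] at h
          obtain ⟨rfl, rfl, rfl⟩ := h
          rfl
    _ ≤ ∑ i ∈ I, (P i ++ (P i).map fun t => (t.1, t.2.2, t.2.1)).toFinset.card :=
        Finset.card_biUnion_le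
    _ ≤ ∑ i ∈ I, 2 * (P i).length := by
        refine Finset.sum_le_sum fun i _ => (List.toFinset_card_le _).trans ?_
        simp only [List.length_append, List.length_map]
        omega

lemma card_mul_pred_le_sum_card_add_sum_length {W : Finset V} {I : Finset ι}
    {L : V → Finset V} {S : ι → List (V × V)}
    (hL : ∀ v ∈ W, ∀ x ∈ W, v ≠ x → x ∉ L v → ∃ i ∈ I, (v, x) ∈ S i) :
    W.card * (W.card - 1) ≤ ∑ v ∈ W, (L v).card + ∑ i ∈ I, (S i).length := by
  calc W.card * (W.card - 1) = W.offDiag.card := by rw [Finset.offDiag_card, Nat.mul_sub_one]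
    _ ≤ ((W.sigma L).image (fun t => (t.1, t.2)) ∪ I.biUnion fun i => (S i).toFinset).card := by
        refine Finset.card_le_card ?_
        rintro ⟨v, x⟩ h
        rw [Finset.mem_offDiag] at h
        by_cases hx : x ∈ L v
        · exact Finset.mem_union_left _ (Finset.mem_image.mpr
            ⟨⟨v, x⟩, Finset.mem_sigma.mpr ⟨h.1, hx⟩, rfl⟩)
        · obtain ⟨i, hi, hS⟩ := hL v h.1 x h.2.1 h.2.2 hx
          exact Finset.mem_union_right _ (Finset.mem_biUnion.mpr ⟨i, hi, List.mem_toFinset.mpr hS⟩)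
    _ ≤ (W.sigma L).card + ∑ i ∈ I, (S i).toFinset.card :=
        (Finset.card_union_le _ _).trans
          (Nat.add_le_add Finset.card_image_le Finset.card_biUnion_le)
    _ ≤ ∑ v ∈ W, (L v).card + ∑ i ∈ I, (S i).length := by
        rw [Finset.card_sigma]
        gcongr
        exact List.toFinset_card_le _

/-- At most `m + 3` collections of few stars and cherries do not cover all cherries on `m + 6`
vertices. -/
lemma not_covered_of_card {m : ℕ} {W : Finset V} {I : Finset ι} (hW : W.card = m + 6)
    (hI : I.card ≤ m + 3) {S : ι → List (V × V)} {P : ι → List (V × V × V)}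
    (hl : ∀ i ∈ I, (S i).length ≤ 5 ∧ (P i).length ≤ 3 ∨ (S i).length ≤ 4 ∧ (P i).length ≤ 5)
    (hcov : ∀ v ∈ W, ∀ x ∈ W, ∀ y ∈ W, v ≠ x → v ≠ y → x ≠ y →
      ∃ i ∈ I, (v, x) ∈ S i ∨ (v, y) ∈ S i ∨ (v, x, y) ∈ P i ∨ (v, y, x) ∈ P i) : False := by
  classical
  let L : V → Finset V := fun v => {x ∈ W | v ≠ x ∧ ∀ i ∈ I, (v, x) ∉ S i}
  have h1 := card_mul_pred_le_sum_card_add_sum_length (W := W) (I := I) (L := L) (S := S)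
    (fun v _ x hx hvx hxL => by simpa [L, hx, hvx] using hxL)
  have h2 := sum_card_mul_pred_le_two_mul_sum_length (W := W) (I := I) (L := L) (P := P)
    (fun v hv x hx y hy hxy => by
      simp only [L, Finset.mem_filter] at hx hy
      obtain ⟨i, hi, h⟩ := hcov v hv x hx.1 y hy.1 hx.2.1 hy.2.1 hxy
      exact ⟨i, hi, by have := hx.2.2 i hi; have := hy.2.2 i hi; tauto⟩)
  have h3 : 2 * (m + 2) * ∑ v ∈ W, (L v).card ≤
      ∑ v ∈ W, (L v).card * ((L v).card - 1) + (m + 6) * ((m + 2) * (m + 3)) := by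
    rw [← hW, ← smul_eq_mul W.card, ← Finset.sum_const, ← Finset.sum_add_distrib,
      Finset.mul_sum]
    refine Finset.sum_le_sum fun v _ => ?_
    generalize (L v).card = t
    rcases le_or_gt t (m + 2) with ht | ht
    · obtain ⟨r, hr⟩ := Nat.exists_eq_add_of_le ht
      rcases t with _ | t
      · simp
      · rw [Nat.add_sub_cancel, show m + 3 = t + 1 + r + 1 by omega, hr]
        nlinarith
    · obtain ⟨r, rfl⟩ := Nat.exists_eq_add_of_lt ht
      rw [Nat.add_sub_cancel]
      nlinarith
  have h4 : 2 * (m + 2) * ∑ i ∈ I, (S i).length + ∑ i ∈ I, 2 * (P i).length ≤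
      (m + 3) * (10 * (m + 2) + 6) := by
    rw [Finset.mul_sum, ← Finset.sum_add_distrib]
    calc _ ≤ ∑ _i ∈ I, (10 * (m + 2) + 6) := Finset.sum_le_sum fun i hi => by
          rcases hl i hi with ⟨hs, hp⟩ | ⟨hs, hp⟩
          · nlinarith
          · nlinarith
      _ ≤ _ := by
        rw [Finset.sum_const, smul_eq_mul]
        gcongr
  rw [hW, show m + 6 - 1 = m + 5 by omega] at h1
  nlinarith [Nat.mul_le_mul_left (2 * (m + 2)) h1, Nat.zero_le (m ^ 3), Nat.zero_le (m ^ 2)]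

end Counting

namespace IntervalFamily

variable {V ι : Type*} [DecidableEq V]

/-- Fewer than `W.card - 2` local interval families do not separate all cherries in `W`. -/
theorem IsLocal.exists_not_before (m : ℕ) {W : Finset V} {I : Finset ι}
    (hW : W.card = m + 5) (hI : I.card ≤ m + 2) {J : ι → IntervalFamily V}
    (hJ : ∀ i ∈ I, (J i).IsLocal W) :
    ∃ v ∈ W, ∃ x ∈ W, ∃ y ∈ W, v ≠ x ∧ v ≠ y ∧ x ≠ y ∧
      ∀ i ∈ I, ¬ (J i).Before W v x y ∧ ¬ (J i).Before W v y x := by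
  classical
  by_contra! hcov
  replace hcov : ∀ v ∈ W, ∀ x ∈ W, ∀ y ∈ W, v ≠ x → v ≠ y → x ≠ y →
      ∃ i ∈ I, (J i).Before W v x y ∨ (J i).Before W v y x := by
    intro v hv x hx y hy h1 h2 h3
    obtain ⟨i, hi, h⟩ := hcov v hv x hx y hy h1 h2 h3
    exact ⟨i, hi, by tauto⟩
  induction m generalizing W I with
  | zero =>
    have key : ∀ i ∈ I, ∀ j ∈ I, I ⊆ {i, j} → False := by
      intro i hi j hj hij
      obtain ⟨a, ha, b, hb, c, hc, h⟩ := (hJ i hi).exists_cherryOrder (by omega)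
      obtain ⟨a', ha', b', hb', c', hc', h'⟩ := (hJ j hj).exists_cherryOrder (by omega)
      refine h.not_covers_of_card_eq_five h' hW ha hb hc ha' hb' hc'
        fun v hv x hx y hy h1 h2 h3 => ?_
      obtain ⟨k, hk, H⟩ := hcov v hv x hx y hy h1 h2 h3
      have := hij hk
      simp only [Finset.mem_insert, Finset.mem_singleton] at this
      rcases this with rfl | rfl
      · exact Or.inl H
      · exact Or.inr H
    obtain ⟨p, hp, q, hq, r, hr, hpq, hpr, hqr⟩ := Finset.two_lt_card.mp (by omega : 2 < W.card)
    obtain ⟨i, hi, -⟩ := hcov p hp q hq r hr hpq hpr hqr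
    have hcard : (I.erase i).card ≤ 1 := by
      rw [Finset.card_erase_of_mem hi]
      omega
    rcases (I.erase i).eq_empty_or_nonempty with h | ⟨j, hj⟩
    · refine key i hi i hi fun k hk => ?_
      have hki : k = i := by
        by_contra hne
        exact Finset.notMem_empty k (h ▸ Finset.mem_erase.mpr ⟨hne, hk⟩)
      simp [hki]
    · refine key i hi j (Finset.mem_of_mem_erase hj) fun k hk => ?_
      by_cases hki : k = i
      · simp [hki]
      · have := Finset.card_le_one.mp hcard k (Finset.mem_erase.mpr ⟨hki, hk⟩) j hj
        simp [this]
  | succ m ih =>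
    by_cases hpure : ∃ i ∈ I, ∃ a ∈ W, ∀ v x y, (J i).Before W v x y → v = a ∨ x = a ∨ y = a
    · obtain ⟨i, hi, a, ha, hpure⟩ := hpure
      refine ih (W := W.erase a) (I := I.erase i) ?_ ?_ ?_ ?_
      · rw [Finset.card_erase_of_mem ha]
        omega
      · rw [Finset.card_erase_of_mem hi]
        omega
      · exact fun j hj => (hJ j (Finset.mem_of_mem_erase hj)).mono (Finset.erase_subset _ _)
      · intro v hv x hx y hy h1 h2 h3
        rw [Finset.mem_erase] at hv hx hy
        obtain ⟨j, hj, H⟩ := hcov v hv.2 x hx.2 y hy.2 h1 h2 h3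
        have hji : j ≠ i := by
          rintro rfl
          rcases H with H | H
          · have := hpure _ _ _ H
            tauto
          · have := hpure _ _ _ H
            tauto
        have hv' := Finset.mem_erase.mpr hv
        have hx' := Finset.mem_erase.mpr hx
        have hy' := Finset.mem_erase.mpr hy
        exact ⟨j, Finset.mem_erase.mpr ⟨hji, hj⟩,
          H.imp (·.congr_of_mem hv' hx' hy') (·.congr_of_mem hv' hy' hx')⟩
    · push Not at hpure
      have hsmall : ∀ i ∈ I, CherryOrder.SmallCover ((J i).Before W) := by
        intro i hi
        obtain ⟨a, ha, b, hb, c, hc, h⟩ := (hJ i hi).exists_cherryOrder (by omega)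
        obtain ⟨v, x, y, H, hv, hx, hy⟩ := hpure i hi a ha
        exact h.smallCover H hv hx hy
      choose! S P hc hl using hsmall
      refine not_covered_of_card (by omega : W.card = m + 6) (by omega : I.card ≤ m + 3) hl
        fun v hv x hx y hy h1 h2 h3 => ?_
      obtain ⟨i, hi, H⟩ := hcov v hv x hx y hy h1 h2 h3
      refine ⟨i, hi, ?_⟩
      rcases H with H | H
      · exact hc i hi v x y H
      · have := hc i hi v y x H
        tauto

end IntervalFamily

section Kneser

variable {n d : ℕ}

lemma kneserGraph_adj {k : ℕ} (hk : k ≠ 0) {e f : {s : Finset (Fin n) // s.card = k}} :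
    (kneserGraph n k).Adj e f ↔ Disjoint e.1 f.1 := by
  rw [kneserGraph, SimpleGraph.fromRel_adj]
  refine ⟨fun h => h.2.elim id fun h => h.symm, fun h => ⟨?_, Or.inl h⟩⟩
  rintro rfl
  rw [disjoint_self, Finset.bot_eq_empty] at h
  exact hk (by rw [← e.2, h, Finset.card_empty])

/-- The two-element set of endpoints of an edge. -/
def pairOfEdge {x y : Fin n} (h : x ≠ y) : {s : Finset (Fin n) // s.card = 2} :=
  ⟨{x, y}, Finset.card_pair h⟩

/-- A box representation of `KG(n,2)` in `ℝ^d` yields `d` local interval families that together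
separate all cherries. -/
lemma exists_intervalFamily_of_isBoxRep {I : {s : Finset (Fin n) // s.card = 2} → Fin d → Set ℝ}
    (h : (kneserGraph n 2).IsBoxRep d I) :
    ∃ J : Fin d → IntervalFamily (Fin n), (∀ i, (J i).IsLocal Finset.univ) ∧
      ∀ v x y : Fin n, v ≠ x → v ≠ y → x ≠ y →
        ∃ i, (J i).Before Finset.univ v x y ∨ (J i).Before Finset.univ v y x := by
  obtain ⟨hI, hadj⟩ := h
  choose lo hi hle hIcc using hI
  classical
  let J : Fin d → IntervalFamily (Fin n) := fun i =>
    { lo := fun e => if he : e.IsDiag then 0 else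
        lo ⟨e.toFinset, Sym2.card_toFinset_of_not_isDiag e he⟩ i
      hi := fun e => if he : e.IsDiag then 0 else
        hi ⟨e.toFinset, Sym2.card_toFinset_of_not_isDiag e he⟩ i
      le := fun e => by
        split_ifs
        · exact le_rfl
        · exact hle _ _ }
  have hlo : ∀ i (x y : Fin n) (hxy : x ≠ y), (J i).lo s(x, y) = lo (pairOfEdge hxy) i := by
    intro i x y hxy
    simp [J, hxy, pairOfEdge, Sym2.toFinset_mk_eq]
  have hhi : ∀ i (x y : Fin n) (hxy : x ≠ y), (J i).hi s(x, y) = hi (pairOfEdge hxy) i := by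
    intro i x y hxy
    simp [J, hxy, pairOfEdge, Sym2.toFinset_mk_eq]
  have hinter : ∀ e f i, (I e i ∩ I f i).Nonempty ↔ lo f i ≤ hi e i ∧ lo e i ≤ hi f i := by
    intro e f i
    rw [hIcc, hIcc, Set.Icc_inter_Icc, Set.nonempty_Icc, max_le_iff, le_min_iff, le_min_iff]
    have := hle e i
    have := hle f i
    tauto
  refine ⟨J, fun i x _ y _ z _ w _ hxy hzw H => ?_, fun v x y hvx hvy hxy => ?_⟩
  · by_contra! hne
    rw [hlo i z w hzw, hhi i x y hxy] at H
    have hdisj : Disjoint (pairOfEdge hxy).1 (pairOfEdge hzw).1 := by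
      simp [pairOfEdge]
      tauto
    have hA := (kneserGraph_adj two_ne_zero).mpr hdisj
    have := (hinter _ _ i).mp ((hadj _ _ hA.ne).mp hA i)
    linarith [this.1]
  · have hne : pairOfEdge hvx ≠ pairOfEdge hvy := fun h => by
      have h : ({v, x} : Finset (Fin n)) = {v, y} := congrArg Subtype.val h
      have : x ∈ ({v, y} : Finset (Fin n)) := h ▸ by simp
      simp only [Finset.mem_insert, Finset.mem_singleton] at this
      tauto
    have hA : ¬ (kneserGraph n 2).Adj (pairOfEdge hvx) (pairOfEdge hvy) := by
      rw [kneserGraph_adj two_ne_zero]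
      simp [pairOfEdge]
    rw [hadj _ _ hne] at hA
    push Not at hA
    obtain ⟨i, hA⟩ := hA
    refine ⟨i, ?_⟩
    rw [← Set.not_nonempty_iff_eq_empty, hinter, not_and_or, not_le, not_le,
      ← hlo i v x hvx, ← hlo i v y hvy, ← hhi i v x hvx, ← hhi i v y hvy] at hA
    simpa [IntervalFamily.Before, hvx, hvy, hxy, hxy.symm] using hA

lemma le_of_isBoxRep_kneserGraph_two (hn : 5 ≤ n)
    {I : {s : Finset (Fin n) // s.card = 2} → Fin d → Set ℝ}
    (h : (kneserGraph n 2).IsBoxRep d I) : n - 2 ≤ d := by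
  by_contra! hd
  obtain ⟨J, hJ, hsep⟩ := exists_intervalFamily_of_isBoxRep h
  obtain ⟨m, rfl⟩ := Nat.exists_eq_add_of_le' hn
  obtain ⟨v, -, x, -, y, -, hvx, hvy, hxy, H⟩ :=
    IntervalFamily.IsLocal.exists_not_before m (W := Finset.univ) (I := Finset.univ)
      (by simp) (by rw [Finset.card_univ, Fintype.card_fin]; omega) (fun i _ => hJ i)
  obtain ⟨i, hi⟩ := hsep v x y hvx hvy hxy
  have := H i (Finset.mem_univ i)
  tauto

end Kneser

section BoxRepresentation

variable {m : ℕ}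

/-- Left end of the `i`-th interval of a pair `e` in the box representation of `KG(m + 2, 2)`:
in direction `a = i + 1`, the pair `{a, x}` is represented by the point `a + x`. -/
def kneserLo (e : Finset (Fin (m + 2))) (i : Fin m) : ℕ :=
  if i.castSucc.succ ∈ e then ∑ x ∈ e, x.val else i + 1 + if 0 ∈ e then 1 else 0

/-- Right end of the `i`-th interval of a pair `e` in the box representation of `KG(m + 2, 2)`. -/
def kneserHi (e : Finset (Fin (m + 2))) (i : Fin m) : ℕ :=
  if i.castSucc.succ ∈ e then ∑ x ∈ e, x.val
  else i + 1 + if Fin.last (m + 1) ∈ e then m else m + 1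

lemma kneserLo_pair {x y : Fin (m + 2)} (h : x ≠ y) (i : Fin m) :
    kneserLo {x, y} i = if i.val + 1 = x ∨ i.val + 1 = y then x.val + y
      else i + 1 + if 0 = x.val ∨ 0 = y.val then 1 else 0 := by
  simp [kneserLo, Finset.sum_pair h, Fin.ext_iff]

lemma kneserHi_pair {x y : Fin (m + 2)} (h : x ≠ y) (i : Fin m) :
    kneserHi {x, y} i = if i.val + 1 = x ∨ i.val + 1 = y then x.val + y
      else i + 1 + if m + 1 = x.val ∨ m + 1 = y.val then m else m + 1 := by
  simp [kneserHi, Finset.sum_pair h, Fin.ext_iff]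

lemma kneserLo_le_kneserHi (e : Finset (Fin (m + 2))) (i : Fin m) :
    kneserLo e i ≤ kneserHi e i := by
  have := i.isLt
  unfold kneserLo kneserHi
  split_ifs <;> omega

lemma kneserLo_le_of_disjoint {x y z w : Fin (m + 2)} (hxy : x ≠ y) (hzw : z ≠ w) (hxz : x ≠ z)
    (hxw : x ≠ w) (hyz : y ≠ z) (hyw : y ≠ w) (i : Fin m) :
    kneserLo {x, y} i ≤ kneserHi {z, w} i := by
  rw [kneserLo_pair hxy, kneserHi_pair hzw]
  simp only [ne_eq, Fin.ext_iff] at hxy hzw hxz hxw hyz hyw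
  split_ifs <;> omega

lemma exists_kneserHi_lt_kneserLo {v x y : Fin (m + 2)} (hvx : v ≠ x) (hvy : v ≠ y)
    (hxy : x ≠ y) :
    ∃ i, kneserHi {v, x} i < kneserLo {v, y} i ∨ kneserHi {v, y} i < kneserLo {v, x} i := by
  suffices H : ∃ a, 1 ≤ a ∧ a ≤ m ∧ ∀ i : Fin m, i.val + 1 = a →
      (kneserHi {v, x} i < kneserLo {v, y} i ∨ kneserHi {v, y} i < kneserLo {v, x} i) by
    obtain ⟨a, h1, h2, H⟩ := H
    exact ⟨⟨a - 1, by omega⟩, H _ (by simp; omega)⟩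
  simp only [kneserLo_pair hvx, kneserLo_pair hvy, kneserHi_pair hvx, kneserHi_pair hvy]
  simp only [ne_eq, Fin.ext_iff] at hvx hvy hxy
  have hv := v.isLt
  have hx := x.isLt
  have hy := y.isLt
  by_cases hv0 : 1 ≤ v.val ∧ v.val ≤ m
  · refine ⟨v, hv0.1, hv0.2, fun i hi => ?_⟩
    split_ifs <;> omega
  by_cases hx0 : 1 ≤ x.val ∧ x.val ≤ m
  · refine ⟨x, hx0.1, hx0.2, fun i hi => ?_⟩
    split_ifs <;> omega
  · refine ⟨y, by omega, by omega, fun i hi => ?_⟩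
    split_ifs <;> omega

lemma kneserGraph_two_isBoxRep :
    (kneserGraph (m + 2) 2).IsBoxRep m
      fun e i => Set.Icc (kneserLo e.1 i : ℝ) (kneserHi e.1 i : ℝ) := by
  refine ⟨fun e i => ⟨_, _, Nat.cast_le.mpr (kneserLo_le_kneserHi e.1 i), rfl⟩, ?_⟩
  rintro ⟨e, he⟩ ⟨f, hf⟩ hne
  rw [kneserGraph_adj two_ne_zero]
  simp only [Set.Icc_inter_Icc, Set.nonempty_Icc, max_le_iff, le_min_iff, Nat.cast_le,
    kneserLo_le_kneserHi, true_and, and_true]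
  constructor
  · intro hd i
    obtain ⟨x, y, hxy, rfl⟩ := Finset.card_eq_two.mp he
    obtain ⟨z, w, hzw, rfl⟩ := Finset.card_eq_two.mp hf
    simp only [Finset.disjoint_insert_left, Finset.disjoint_singleton_left, Finset.mem_insert,
      Finset.mem_singleton, not_or] at hd
    obtain ⟨⟨hxz, hxw⟩, hyz, hyw⟩ := hd
    exact ⟨kneserLo_le_of_disjoint hzw hxy (Ne.symm hxz) (Ne.symm hyz) (Ne.symm hxw)
      (Ne.symm hyw) i, kneserLo_le_of_disjoint hxy hzw hxz hxw hyz hyw i⟩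
  · intro H
    by_contra hd
    obtain ⟨v, hve, hvf⟩ := Finset.not_disjoint_iff.mp hd
    obtain ⟨x, hx⟩ := Finset.card_eq_one.mp
      ((Finset.card_erase_of_mem hve).trans (by rw [he]) : (e.erase v).card = 1)
    obtain ⟨y, hy⟩ := Finset.card_eq_one.mp
      ((Finset.card_erase_of_mem hvf).trans (by rw [hf]) : (f.erase v).card = 1)
    have hvx : v ≠ x := (Finset.ne_of_mem_erase (hx ▸ Finset.mem_singleton_self x)).symm
    have hvy : v ≠ y := (Finset.ne_of_mem_erase (hy ▸ Finset.mem_singleton_self y)).symm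
    obtain rfl : e = {v, x} := by rw [← Finset.insert_erase hve, hx]
    obtain rfl : f = {v, y} := by rw [← Finset.insert_erase hvf, hy]
    have hxy : x ≠ y := by
      rintro rfl
      exact hne rfl
    obtain ⟨i, hi⟩ := exists_kneserHi_lt_kneserLo hvx hvy hxy
    have := H i
    omega

end BoxRepresentation

/-- For every `n ≥ 5`, the boxicity of the Kneser graph `KG(n,2)` equals `n - 2`. -/
theorem boxicity_kneserGraph_two (n : ℕ) (hn : 5 ≤ n) :
    (kneserGraph n 2).boxicity = n - 2 := by
  obtain ⟨m, rfl⟩ := Nat.exists_eq_add_of_le' (show 2 ≤ n by omega)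
  rw [Nat.add_sub_cancel]
  refine IsLeast.csInf_eq ⟨⟨_, kneserGraph_two_isBoxRep⟩, ?_⟩
  rintro d ⟨I, hI⟩
  have := le_of_isBoxRep_kneserGraph_two hn hI
  omega
end

section
/- Let n ≥ 5 and let H be a maximal interval-order subgraph of the line graph L(K_n). Then there exist five distinct vertices a, b, c, d, e of K_n such that the edge set of H equals one of the following subsets of E(L(K_n)): (a) Q_a ∪ δ_{ab} ∪ δ_{ad} ∪ K_{{a,b,c}} ∪ K_{{a,d,e}}; (b) δ_{ab} ∪ δ_{ad} ∪ K_{{a,b,c,d}}; (c) δ_{ab} ∪ δ_{ad} ∪ δ_{ac⁻} ∪ K_{{a,b,c}} ∪ K_{{a,b,d}} ∪ K_{a,d,c⁻} ∪ K_{b,c,d⁻}, or the same set with δ_{ad} replaced by δ_{bc}. -/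
namespace LineGraphComplete

variable {n : ℕ}

/-- The vertex type of `L(K_n)`: the edges of the complete graph `K_n`. -/
abbrev EKn (n : ℕ) := (⊤ : SimpleGraph (Fin n)).edgeSet

/-- `Q_v`: the edges of `L(K_n)` joining two distinct edges of `K_n` both incident to `v`
(the clique on `δ(v)`). -/
def Q (v : Fin n) : SimpleGraph (EKn n) :=
  SimpleGraph.fromRel (fun e f => v ∈ (e : Sym2 (Fin n)) ∧ v ∈ (f : Sym2 (Fin n)))

/-- `δ_{uv}`: the edges of `L(K_n)` joining the edge `uv` to the other edges of `K_n`
incident to `u` or to `v` (the star of centre `uv`). -/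
def delta (u v : Fin n) : SimpleGraph (EKn n) :=
  SimpleGraph.fromRel (fun e f =>
    (e : Sym2 (Fin n)) = s(u, v) ∧ (u ∈ (f : Sym2 (Fin n)) ∨ v ∈ (f : Sym2 (Fin n))))

/-- `δ_{uv⁻}`: the edges of `L(K_n)` joining the edge `uv` to the other edges of `K_n`
incident to `u`. -/
def deltaMinus (u v : Fin n) : SimpleGraph (EKn n) :=
  SimpleGraph.fromRel (fun e f => (e : Sym2 (Fin n)) = s(u, v) ∧ u ∈ (f : Sym2 (Fin n)))

/-- `K_U`: the edges of `L(K_n)` joining two distinct intersecting edges of `K_n` whose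
endpoints all lie in `U` (the edge set of `L(K_n[U])`). -/
def KU (U : Set (Fin n)) : SimpleGraph (EKn n) :=
  SimpleGraph.fromRel (fun e f =>
    (∀ x ∈ (e : Sym2 (Fin n)), x ∈ U) ∧ (∀ x ∈ (f : Sym2 (Fin n)), x ∈ U) ∧
      ∃ x : Fin n, x ∈ (e : Sym2 (Fin n)) ∧ x ∈ (f : Sym2 (Fin n)))

/-- `K_{u,v,w⁻}`: the two edges of `L(K_n)` joining `uv` to `uw` and joining `uv` to `vw`. -/
def Ktri (u v w : Fin n) : SimpleGraph (EKn n) :=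
  SimpleGraph.fromRel (fun e f =>
    (e : Sym2 (Fin n)) = s(u, v) ∧
      ((f : Sym2 (Fin n)) = s(u, w) ∨ (f : Sym2 (Fin n)) = s(v, w)))

/-- `H` is a maximal interval-order subgraph of `L(K_n)`. -/
abbrev IsMaximalIntervalOrder (H : SimpleGraph (EKn n)) : Prop :=
  Maximal (fun H' : SimpleGraph (EKn n) =>
    H' ≤ (⊤ : SimpleGraph (Fin n)).lineGraph ∧ H'.IsIntervalOrderGraph) H

/-- If `H` is maximal among the interval-order subgraphs of `L(K_n)` and `H ≤ F`, then `H = F` as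
soon as intervals `[L e, R e]` are given which are disjoint for `F`-adjacent edges and which meet
for disjoint edges of `K_n`. -/
lemma eq_of_le_of_intervals {H F : SimpleGraph (EKn n)} (hH : IsMaximalIntervalOrder H)
    (hHF : H ≤ F) (L R : Sym2 (Fin n) → ℕ) (hLR : ∀ u v, u ≠ v → L s(u, v) ≤ R s(u, v))
    (hmeet : ∀ u v x y, u ≠ v → x ≠ y → R s(u, v) < L s(x, y) → u = x ∨ u = y ∨ v = x ∨ v = y)
    (hF : ∀ u v x y (huv : u ≠ v) (hxy : x ≠ y), s(u, v) ≠ s(x, y) →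
      F.Adj ⟨s(u, v), huv⟩ ⟨s(x, y), hxy⟩ →
      R s(u, v) < L s(x, y) ∨ R s(x, y) < L s(u, v)) :
    H = F := by
  have hLR' : ∀ e : EKn n, L e ≤ R e := by
    rintro ⟨⟨u, v⟩, h⟩
    exact hLR u v h
  let F' : SimpleGraph (EKn n) :=
    { Adj := fun e f => R e < L f ∨ R f < L e
      symm := ⟨fun _ _ h => h.symm⟩
      loopless := ⟨fun e h => by have := hLR' e; omega⟩ }
  have hFF' : F ≤ F' := by
    rintro ⟨⟨u, v⟩, huv⟩ ⟨⟨x, y⟩, hxy⟩ h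
    exact hF u v x y huv hxy (fun h' => h.ne (Subtype.ext h')) h
  have hF'l : F' ≤ (⊤ : SimpleGraph (Fin n)).lineGraph := by
    rintro ⟨⟨u, v⟩, huv⟩ ⟨⟨x, y⟩, hxy⟩ h
    refine ⟨h.ne, ?_⟩
    have key : u = x ∨ u = y ∨ v = x ∨ v = y := by
      rcases h with h | h
      · exact hmeet u v x y huv hxy h
      · rcases hmeet x y u v hxy huv h with h | h | h | h <;> simp [h]
    rcases key with rfl | rfl | rfl | rfl
    · exact ⟨u, by simp⟩
    · exact ⟨u, by simp⟩
    · exact ⟨v, by simp⟩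
    · exact ⟨v, by simp⟩
  have hF'i : F'.IsIntervalOrderGraph := by
    refine ⟨fun e => Set.Icc (L e) (R e),
      fun e => ⟨L e, R e, by exact_mod_cast hLR' e, rfl⟩, fun e f hef => ?_⟩
    have he := hLR' e
    have hf := hLR' f
    rw [SimpleGraph.compl_adj, Set.Icc_inter_Icc, Set.nonempty_Icc]
    simp only [F', sup_le_iff, le_inf_iff, Nat.cast_le]
    grind
  exact le_antisymm hHF (hFF'.trans (hH.2 ⟨hF'l, hF'i⟩ (hHF.trans hFF')))

/-- The graph of form (a). -/
def formA (a b c d e : Fin n) : SimpleGraph (EKn n) :=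
  Q a ⊔ delta a b ⊔ delta a d ⊔ KU {a, b, c} ⊔ KU {a, d, e}

/-- The graph of form (b). -/
def formB (a b c d : Fin n) : SimpleGraph (EKn n) :=
  delta a b ⊔ delta a d ⊔ KU {a, b, c, d}

/-- The graph of form (c), first variant. -/
def formC (a b c d : Fin n) : SimpleGraph (EKn n) :=
  delta a b ⊔ delta a d ⊔ deltaMinus a c ⊔ KU {a, b, c} ⊔ KU {a, b, d} ⊔ Ktri a d c ⊔ Ktri b c d

/-- The graph of form (c), second variant. -/
def formC' (a b c d : Fin n) : SimpleGraph (EKn n) :=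
  delta a b ⊔ delta b c ⊔ deltaMinus a c ⊔ KU {a, b, c} ⊔ KU {a, b, d} ⊔ Ktri a d c ⊔ Ktri b c d

/-- The sum of the two endpoints. -/
def endSum : Sym2 (Fin n) → ℕ :=
  Sym2.lift ⟨fun u v => u.val + v.val, fun _ _ => Nat.add_comm _ _⟩

lemma endSum_mk (u v : Fin n) : endSum s(u, v) = u.val + v.val := rfl

section Maximal

variable {H : SimpleGraph (EKn n)} {a b c d e : Fin n}

lemma eq_formB (hH : IsMaximalIntervalOrder H) (hnd : [a, b, c, d].Nodup) (h : H ≤ formB a b c d) :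
    H = formB a b c d := by
  refine eq_of_le_of_intervals hH h
    (fun z => if z = s(a, b) then 0 else if z = s(a, d) then 10 else
      if z = s(a, c) ∨ z = s(b, d) then 5 else if z = s(b, c) then 9 else
      if a ∈ z ∨ b ∈ z then 1 else 0)
    (fun z => if z = s(a, b) then 0 else if z = s(a, d) then 10 else
      if z = s(a, c) ∨ z = s(b, d) then 5 else if z = s(c, d) then 1 else
      if a ∈ z ∨ d ∈ z then 9 else 10) ?_ ?_ ?_ <;>
    clear hH h
  · intro u v huv
    simp only [Sym2.eq_iff, Sym2.mem_iff, List.nodup_cons, List.mem_cons, not_or,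
      List.not_mem_nil] at *
    grind (splits := 40)
  · intro u v x y huv hxy
    simp only [Sym2.eq_iff, Sym2.mem_iff, List.nodup_cons, List.mem_cons, not_or,
      List.not_mem_nil] at *
    grind (splits := 40)
  · intro u v x y huv hxy hne hF
    simp only [formB, delta, KU, SimpleGraph.sup_adj, SimpleGraph.fromRel_adj, forall_eq_or_imp,
      forall_eq, or_and_right, exists_or, exists_eq_left,
      Sym2.eq_iff, Sym2.mem_iff, ne_eq, Set.mem_insert_iff, Set.mem_singleton_iff,
      List.nodup_cons, List.mem_cons, not_or,
      List.not_mem_nil] at *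
    grind (splits := 40)

lemma eq_formC (hH : IsMaximalIntervalOrder H) (hnd : [a, b, c, d].Nodup)
    (h : H ≤ formC a b c d) : H = formC a b c d := by
  refine eq_of_le_of_intervals hH h
    (fun z => if z = s(a, b) then 0 else if z = s(a, d) then 10 else if z = s(a, c) then 2 else
      if z = s(b, c) then 5 else if z = s(b, d) then 1 else if a ∈ z then 3 else
      if b ∈ z then 1 else 0)
    (fun z => if z = s(a, b) then 0 else if z = s(a, d) then 10 else if z = s(a, c) then 2 else
      if z = s(b, d) ∨ z = s(c, d) then 4 else if a ∈ z ∨ d ∈ z then 9 else 10) ?_ ?_ ?_ <;>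
    clear hH h
  · intro u v huv
    simp only [Sym2.eq_iff, Sym2.mem_iff, List.nodup_cons, List.mem_cons, not_or,
      List.not_mem_nil] at *
    grind (splits := 40)
  · intro u v x y huv hxy
    simp only [Sym2.eq_iff, Sym2.mem_iff, List.nodup_cons, List.mem_cons, not_or,
      List.not_mem_nil] at *
    grind (splits := 40)
  · intro u v x y huv hxy hne hF
    simp only [formC, delta, deltaMinus, KU, Ktri, SimpleGraph.sup_adj, SimpleGraph.fromRel_adj,
      forall_eq_or_imp, forall_eq, or_and_right, exists_or, exists_eq_left, Sym2.eq_iff,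
      Sym2.mem_iff, ne_eq, Set.mem_insert_iff, Set.mem_singleton_iff, List.nodup_cons, List.mem_cons, not_or,
      List.not_mem_nil] at *
    grind (splits := 40)

lemma eq_formC' (hH : IsMaximalIntervalOrder H) (hnd : [a, b, c, d].Nodup)
    (h : H ≤ formC' a b c d) : H = formC' a b c d := by
  refine eq_of_le_of_intervals hH h
    (fun z => if z = s(a, b) then 0 else if z = s(b, c) then 10 else if z = s(a, c) then 2 else
      if z = s(a, d) then 5 else if z = s(b, d) then 1 else if a ∈ z then 3 else
      if b ∈ z then 1 else 0)
    (fun z => if z = s(a, b) then 0 else if z = s(b, c) then 10 else if z = s(a, c) then 2 else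
      if z = s(b, d) ∨ z = s(c, d) then 4 else if b ∈ z ∨ c ∈ z then 9 else 10) ?_ ?_ ?_ <;>
    clear hH h
  · intro u v huv
    simp only [Sym2.eq_iff, Sym2.mem_iff, List.nodup_cons, List.mem_cons, not_or,
      List.not_mem_nil] at *
    grind (splits := 40)
  · intro u v x y huv hxy
    simp only [Sym2.eq_iff, Sym2.mem_iff, List.nodup_cons, List.mem_cons, not_or,
      List.not_mem_nil] at *
    grind (splits := 40)
  · intro u v x y huv hxy hne hF
    simp only [formC', delta, deltaMinus, KU, Ktri, SimpleGraph.sup_adj, SimpleGraph.fromRel_adj,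
      forall_eq_or_imp, forall_eq, or_and_right, exists_or, exists_eq_left, Sym2.eq_iff,
      Sym2.mem_iff, ne_eq, Set.mem_insert_iff, Set.mem_singleton_iff, List.nodup_cons, List.mem_cons, not_or,
      List.not_mem_nil] at *
    grind (splits := 40)

lemma eq_formA (hH : IsMaximalIntervalOrder H) (hnd : [a, b, c, d, e].Nodup)
    (h : H ≤ formA a b c d e) : H = formA a b c d e := by
  refine eq_of_le_of_intervals hH h
    (fun z => if z = s(a, b) then 0 else if z = s(a, c) then 2 else
      if z = s(a, e) then 2 * n + 8 else if z = s(a, d) then 2 * n + 10 else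
      if a ∈ z then 4 + endSum z else if z = s(b, c) then 3 else if b ∈ z then 1 else 0)
    (fun z => if z = s(a, b) then 0 else if z = s(a, c) then 2 else
      if z = s(a, e) then 2 * n + 8 else if z = s(a, d) then 2 * n + 10 else
      if a ∈ z then 4 + endSum z else if z = s(d, e) then 2 * n + 7 else
      if d ∈ z then 2 * n + 9 else 2 * n + 10) ?_ ?_ ?_ <;>
    clear hH h
  · intro u v huv
    simp only [Sym2.eq_iff, Sym2.mem_iff, List.nodup_cons, List.mem_cons, not_or,
      List.not_mem_nil, endSum_mk] at *
    grind (splits := 40)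
  · intro u v x y huv hxy
    simp only [Sym2.eq_iff, Sym2.mem_iff, List.nodup_cons, List.mem_cons, not_or,
      List.not_mem_nil, endSum_mk] at *
    grind (splits := 40)
  · intro u v x y huv hxy hne hF
    simp only [formA, Q, delta, KU, SimpleGraph.sup_adj, SimpleGraph.fromRel_adj,
      forall_eq_or_imp, forall_eq, or_and_right, exists_or, exists_eq_left, Sym2.eq_iff,
      Sym2.mem_iff, ne_eq, Set.mem_insert_iff, Set.mem_singleton_iff, List.nodup_cons, List.mem_cons, not_or,
      List.not_mem_nil, endSum_mk] at *
    grind (splits := 40)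

end Maximal

/-- An irreflexive `2 + 2`-free (that is, interval order) relation between edges of `K_n` which
only relates edges sharing an endpoint. -/
structure IsSharingOrder (p : Sym2 (Fin n) → Sym2 (Fin n) → Prop) : Prop where
  not_diag : ∀ {u v x y}, p s(u, v) s(x, y) → u ≠ v ∧ x ≠ y
  irrefl : ∀ z, ¬ p z z
  ferrers : ∀ {z w z' w'}, p z w → p z' w' → p z w' ∨ p z' w
  share : ∀ {u v x y}, p s(u, v) s(x, y) → u = x ∨ u = y ∨ v = x ∨ v = y

/-- The relation `p` is contained in one of the graphs of the forms (a), (b), (c). -/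
def Covered (p : Sym2 (Fin n) → Sym2 (Fin n) → Prop) : Prop :=
  ∃ a b c d e : Fin n, [a, b, c, d, e].Nodup ∧ ∃ G : SimpleGraph (EKn n),
    (G = formA a b c d e ∨ G = formB a b c d ∨ G = formC a b c d ∨ G = formC' a b c d) ∧
    ∀ z w : EKn n, p z w → G.Adj z w

lemma Covered.of_flip {p : Sym2 (Fin n) → Sym2 (Fin n) → Prop} (h : Covered (flip p)) :
    Covered p := by
  obtain ⟨a, b, c, d, e, hnd, G, hG, hp⟩ := h
  exact ⟨a, b, c, d, e, hnd, G, hG, fun z w hzw => (hp w z hzw).symm⟩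

/-- The vertex `x` is none of `a`, `b`, `c`. -/
def Off (a b c x : Fin n) : Prop := x ≠ a ∧ x ≠ b ∧ x ≠ c

/-- A sharing order whose first element is `ab` and whose last element is `ac`. -/
structure IsAnchored (p : Sym2 (Fin n) → Sym2 (Fin n) → Prop) (a b c : Fin n) : Prop
    extends IsSharingOrder p where
  ne_ab : a ≠ b
  ne_ac : a ≠ c
  ne_bc : b ≠ c
  first : ∀ {z w}, p z w → p s(a, b) w
  last : ∀ {z w}, p z w → p z s(a, c)

lemma delta_comm (u v : Fin n) : delta u v = delta v u := by
  ext z w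
  simp only [delta, SimpleGraph.fromRel_adj, Sym2.eq_swap (a := u), or_comm (a := u ∈ _)]

namespace IsAnchored

variable {p : Sym2 (Fin n) → Sym2 (Fin n) → Prop} {a b c : Fin n}

lemma flip (h : IsAnchored p a b c) : IsAnchored (flip p) a c b where
  not_diag h' := (h.not_diag h').symm
  irrefl z := h.irrefl z
  ferrers h₁ h₂ := (h.ferrers h₁ h₂).symm
  share h' := by have := h.share h'; grind
  ne_ab := h.ne_ac
  ne_ac := h.ne_ab
  ne_bc := h.ne_bc.symm
  first h' := h.last h'
  last h' := h.first h'

lemma trans (h : IsAnchored p a b c) {z w t : Sym2 (Fin n)} (h₁ : p z w) (h₂ : p w t) : p z t :=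
  (h.ferrers h₁ h₂).resolve_right (h.irrefl w)

lemma classify (h : IsAnchored p a b c) {z w : Sym2 (Fin n)} (hp : p z w) :
    (z = s(a, b) ∨ w = s(a, b) ∨ z = s(a, c) ∨ w = s(a, c)) ∨
    ∃ x, Off a b c x ∧
      ((∃ y, Off a b c y ∧ y ≠ x ∧ z = s(a, x) ∧ w = s(a, y)) ∨
        (z = s(a, x) ∧ w = s(b, x)) ∨ (z = s(c, x) ∧ w = s(a, x)) ∨
        (z = s(c, x) ∧ w = s(b, x)) ∨ (z = s(c, x) ∧ w = s(c, b)) ∨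
        (z = s(c, b) ∧ w = s(b, x))) := by
  have hz : ∃ x, z = s(a, x) ∨ z = s(c, x) := by
    induction z with | h u v =>
    rcases h.share (h.last hp) with rfl | rfl | rfl | rfl
    exacts [⟨v, .inl rfl⟩, ⟨v, .inr rfl⟩, ⟨u, .inl Sym2.eq_swap⟩, ⟨u, .inr Sym2.eq_swap⟩]
  have hw : ∃ y, w = s(a, y) ∨ w = s(b, y) := by
    induction w with | h u v =>
    rcases h.share (h.first hp) with rfl | rfl | rfl | rfl
    exacts [⟨v, .inl rfl⟩, ⟨u, .inl Sym2.eq_swap⟩, ⟨v, .inr rfl⟩, ⟨u, .inr Sym2.eq_swap⟩]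
  obtain ⟨x, hx⟩ := hz
  obtain ⟨y, hy⟩ := hw
  have hab := h.ne_ab
  have hac := h.ne_ac
  have hbc := h.ne_bc
  have hirr : ¬ z = w := fun h' => h.irrefl z (h' ▸ hp)
  refine or_iff_not_imp_left.2 fun hn => ?_
  rcases hx with rfl | rfl <;> rcases hy with rfl | rfl <;>
    have hs := h.share hp <;> have hd := h.not_diag hp <;>
    simp only [Sym2.eq_iff, Off] at *
  · exact ⟨x, by grind, .inl ⟨y, by grind⟩⟩
  · exact ⟨x, by grind⟩
  · exact ⟨x, by grind⟩
  · by_cases hxb : x = b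
    · exact ⟨y, by grind⟩
    · exact ⟨x, by grind⟩

lemma adj_of_kinds (h : IsAnchored p a b c) {G : SimpleGraph (EKn n)} (hGb : delta a b ≤ G)
    (hGc : delta a c ≤ G)
    (hG : ∀ z w : EKn n, z ≠ w → p z w → ∀ x, Off a b c x →
      ((∃ y, Off a b c y ∧ y ≠ x ∧ z.1 = s(a, x) ∧ w.1 = s(a, y)) ∨
        (z.1 = s(a, x) ∧ w.1 = s(b, x)) ∨ (z.1 = s(c, x) ∧ w.1 = s(a, x)) ∨
        (z.1 = s(c, x) ∧ w.1 = s(b, x)) ∨ (z.1 = s(c, x) ∧ w.1 = s(c, b)) ∨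
        (z.1 = s(c, b) ∧ w.1 = s(b, x))) → G.Adj z w)
    (z w : EKn n) (hp : p z w) : G.Adj z w := by
  have hne : z ≠ w := fun h' => h.irrefl z (by rwa [← h'] at hp)
  have hd : ∀ t, (z.1 = s(a, t) ∨ w.1 = s(a, t)) → (delta a t).Adj z w := by
    intro t ht
    refine ⟨hne, ?_⟩
    obtain ⟨⟨u, v⟩, huv⟩ := z
    obtain ⟨⟨x, y⟩, hxy⟩ := w
    have hs := h.share hp
    refine ht.imp (fun ht => ⟨ht, ?_⟩) (fun ht => ⟨ht, ?_⟩) <;>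
      simp only [Sym2.eq_iff, Sym2.mem_iff] at ht ⊢ <;> grind
  rcases h.classify hp with (h' | h' | h' | h') | ⟨x, hx, hk⟩
  · exact hGb (hd b (.inl h'))
  · exact hGb (hd b (.inr h'))
  · exact hGc (hd c (.inl h'))
  · exact hGc (hd c (.inr h'))
  · exact hG z w hne hp x hx hk

lemma covered_formA (h : IsAnchored p a b c) {x y : Fin n} (hx : Off a b c x)
    (hy : Off a b c y) (hxy : x ≠ y)
    (hB : ∀ z, Off a b c z → p s(a, z) s(b, z) → z = x)
    (hC : ∀ z, Off a b c z → p s(c, z) s(a, z) → z = y)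
    (hD : ∀ z, Off a b c z → ¬ p s(c, z) s(b, z))
    (hU : ∀ z, Off a b c z → ¬ p s(c, z) s(c, b))
    (hW : ∀ z, Off a b c z → ¬ p s(c, b) s(b, z)) : Covered p := by
  have hab := h.ne_ab
  have hac := h.ne_ac
  have hbc := h.ne_bc
  refine ⟨a, b, x, c, y, by simp; grind [Off], _, .inl rfl, h.adj_of_kinds ?_ ?_ ?_⟩
  · intro z w hzw
    simp [formA, hzw]
  · intro z w hzw
    simp [formA, hzw]
  intro z w hne hp t ht hk
  rcases hk with ⟨s, hs, hst, hz, hw⟩ | ⟨hz, hw⟩ | ⟨hz, hw⟩ | ⟨hz, hw⟩ | ⟨hz, hw⟩ | ⟨hz, hw⟩ <;>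
    rw [hz, hw] at hp
  · simp [formA, Q, KU, hz, hw, hne]
  · obtain rfl := hB t ht hp
    simp [formA, KU, hz, hw, hne]
  · obtain rfl := hC t ht hp
    simp [formA, KU, hz, hw, hne]
  · exact absurd hp (hD t ht)
  · exact absurd hp (hU t ht)
  · exact absurd hp (hW t ht)

lemma covered_formB (h : IsAnchored p a b c) {x e : Fin n} (hx : Off a b c x)
    (he : Off a b c e ∧ e ≠ x)
    (hA : ∀ z w, Off a b c z → Off a b c w → ¬ p s(a, z) s(a, w))
    (hB : ∀ z, Off a b c z → p s(a, z) s(b, z) → z = x)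
    (hC : ∀ z, Off a b c z → p s(c, z) s(a, z) → z = x)
    (hD : ∀ z, Off a b c z → p s(c, z) s(b, z) → z = x)
    (hU : ∀ z, Off a b c z → p s(c, z) s(c, b) → z = x)
    (hW : ∀ z, Off a b c z → p s(c, b) s(b, z) → z = x) : Covered p := by
  have hab := h.ne_ab
  have hac := h.ne_ac
  have hbc := h.ne_bc
  refine ⟨a, b, x, c, e, by simp; grind [Off], _, .inr (.inl rfl), h.adj_of_kinds ?_ ?_ ?_⟩
  · intro z w hzw
    simp [formB, hzw]
  · intro z w hzw
    simp [formB, hzw]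
  intro z w hne hp t ht hk
  rcases hk with ⟨s, hs, hst, hz, hw⟩ | ⟨hz, hw⟩ | ⟨hz, hw⟩ | ⟨hz, hw⟩ | ⟨hz, hw⟩ | ⟨hz, hw⟩ <;>
    rw [hz, hw] at hp
  · exact absurd hp (hA t s ht hs)
  · obtain rfl := hB t ht hp
    simp [formB, KU, hz, hw, hne]
  · obtain rfl := hC t ht hp
    simp [formB, KU, hz, hw, hne]
  · obtain rfl := hD t ht hp
    simp [formB, KU, hz, hw, hne]
  · obtain rfl := hU t ht hp
    simp [formB, KU, hz, hw, hne]
  · obtain rfl := hW t ht hp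
    simp [formB, KU, hz, hw, hne]

lemma covered_formC (h : IsAnchored p a b c) {x e : Fin n} (hx : Off a b c x)
    (he : Off a b c e ∧ e ≠ x)
    (hA : ∀ z w, Off a b c z → Off a b c w → p s(a, z) s(a, w) → z = x ∨ w = x)
    (hB : ∀ z, Off a b c z → p s(a, z) s(b, z) → z = x)
    (hC : ∀ z, Off a b c z → ¬ p s(c, z) s(a, z))
    (hD : ∀ z, Off a b c z → p s(c, z) s(b, z) → z = x)
    (hU : ∀ z, Off a b c z → ¬ p s(c, z) s(c, b))
    (hW : ∀ z, Off a b c z → p s(c, b) s(b, z) → z = x) : Covered p := by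
  have hab := h.ne_ab
  have hac := h.ne_ac
  have hbc := h.ne_bc
  refine ⟨a, b, x, c, e, by simp; grind [Off], _, .inr (.inr (.inl rfl)), h.adj_of_kinds ?_ ?_ ?_⟩
  · intro z w hzw
    simp [formC, hzw]
  · intro z w hzw
    simp [formC, hzw]
  intro z w hne hp t ht hk
  rcases hk with ⟨s, hs, hst, hz, hw⟩ | ⟨hz, hw⟩ | ⟨hz, hw⟩ | ⟨hz, hw⟩ | ⟨hz, hw⟩ | ⟨hz, hw⟩ <;>
    rw [hz, hw] at hp
  · rcases hA t s ht hs hp with rfl | rfl <;> simp [formC, deltaMinus, hz, hw, hne]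
  · obtain rfl := hB t ht hp
    simp [formC, KU, hz, hw, hne]
  · exact absurd hp (hC t ht)
  · obtain rfl := hD t ht hp
    simp [formC, Ktri, hz, hw, hne, Sym2.eq_swap]
  · exact absurd hp (hU t ht)
  · obtain rfl := hW t ht hp
    simp [formC, Ktri, hz, hw, hne, Sym2.eq_swap]

lemma covered_formC' (h : IsAnchored p a b c) {x e : Fin n} (hx : Off a b c x)
    (he : Off a b c e ∧ e ≠ x)
    (hA : ∀ z w, Off a b c z → Off a b c w → ¬ p s(a, z) s(a, w))
    (hB : ∀ z, Off a b c z → p s(a, z) s(b, z) → z = x)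
    (hC : ∀ z, Off a b c z → ¬ p s(c, z) s(a, z))
    (hD : ∀ z, Off a b c z → p s(c, z) s(b, z) → z = x)
    (hU : ∀ z, Off a b c z → ¬ p s(c, z) s(c, b)) :
    Covered p := by
  have hab := h.ne_ab
  have hac := h.ne_ac
  have hbc := h.ne_bc
  refine ⟨b, a, c, x, e, by simp; grind [Off], _, .inr (.inr (.inr rfl)), h.adj_of_kinds ?_ ?_ ?_⟩
  · rintro z w hzw
    rw [delta_comm] at hzw
    simp [formC', hzw]
  · intro z w hzw
    simp [formC', hzw]
  intro z w hne hp t ht hk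
  rcases hk with ⟨s, hs, hst, hz, hw⟩ | ⟨hz, hw⟩ | ⟨hz, hw⟩ | ⟨hz, hw⟩ | ⟨hz, hw⟩ | ⟨hz, hw⟩ <;>
    rw [hz, hw] at hp
  · exact absurd hp (hA t s ht hs)
  · obtain rfl := hB t ht hp
    simp [formC', KU, hz, hw, hne]
  · exact absurd hp (hC t ht)
  · obtain rfl := hD t ht hp
    simp [formC', Ktri, hz, hw, hne, Sym2.eq_swap]
  · exact absurd hp (hU t ht)
  · simp [formC', deltaMinus, hz, hw, hne, Sym2.eq_swap]

lemma eq_of_rel_ax_bx (h : IsAnchored p a b c) {x y : Fin n} (hx : Off a b c x)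
    (hy : Off a b c y) (hBx : p s(a, x) s(b, x)) (hBy : p s(a, y) s(b, y)) : x = y := by
  have hab := h.ne_ab
  unfold Off at hx hy
  rcases h.ferrers hBx hBy with h' | h' <;> have := h.share h' <;> grind

lemma eq_of_rel_cx_bx (h : IsAnchored p a b c) {x y : Fin n} (hx : Off a b c x)
    (hy : Off a b c y) (hDx : p s(c, x) s(b, x)) (hDy : p s(c, y) s(b, y)) : x = y := by
  have hbc := h.ne_bc
  unfold Off at hx hy
  rcases h.ferrers hDx hDy with h' | h' <;> have := h.share h' <;> grind

lemma eq_of_rel_cx_bx_of_rel_ax_bx (h : IsAnchored p a b c) {x y : Fin n} (hx : Off a b c x)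
    (hy : Off a b c y) (hDx : p s(c, x) s(b, x)) (hBy : p s(a, y) s(b, y)) : y = x := by
  have hbc := h.ne_bc
  have hab := h.ne_ab
  unfold Off at hx hy
  rcases h.ferrers hDx hBy with h' | h' <;> have := h.share h' <;> grind

lemma eq_of_rel_cx_cb_of_rel_cb_bx (h : IsAnchored p a b c) {x y : Fin n} (hx : Off a b c x)
    (hy : Off a b c y) (hUx : p s(c, x) s(c, b)) (hWy : p s(c, b) s(b, y)) : x = y := by
  have hbc := h.ne_bc
  unfold Off at hx hy
  have := h.share (h.trans hUx hWy)
  grind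

lemma eq_of_rel_cb_bx_of_rel_ax_ay (h : IsAnchored p a b c) {x y z : Fin n} (hx : Off a b c x)
    (hy : Off a b c y) (hz : Off a b c z) (hWx : p s(c, b) s(b, x))
    (hA : p s(a, y) s(a, z)) : y = x ∧ p s(a, x) s(b, x) := by
  have hab := h.ne_ab
  have hac := h.ne_ac
  unfold Off at hx hy hz
  rcases h.ferrers hWx hA with h' | h' <;> have := h.share h' <;> grind

lemma eq_of_rel_cb_bx_of_rel_cx_ax (h : IsAnchored p a b c) {x y : Fin n} (hx : Off a b c x)
    (hy : Off a b c y) (hWx : p s(c, b) s(b, x)) (hCy : p s(c, y) s(a, y)) :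
    y = x ∧ p s(c, x) s(b, x) := by
  have hab := h.ne_ab
  have hac := h.ne_ac
  have hbc := h.ne_bc
  unfold Off at hx hy
  rcases h.ferrers hWx hCy with h' | h' <;> have := h.share h' <;> grind

lemma eq_or_eq_of_rel_cx_bx_of_rel_ax_ay (h : IsAnchored p a b c) {x y z : Fin n}
    (hx : Off a b c x) (hy : Off a b c y) (hz : Off a b c z) (hDx : p s(c, x) s(b, x))
    (hA : p s(a, y) s(a, z)) : y = x ∨ z = x := by
  have hab := h.ne_ab
  have hac := h.ne_ac
  unfold Off at hx hy hz
  rcases h.ferrers hDx hA with h' | h' <;> have := h.share h' <;> grind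

lemma not_rel_ax_ay_of_rel_cx_ax (h : IsAnchored p a b c) {x y : Fin n} (hx : Off a b c x)
    (hy : Off a b c y) (hCx : p s(c, x) s(a, x)) : ¬ p s(a, x) s(a, y) := by
  intro hA
  have hac := h.ne_ac
  have hxy : ¬ x = y := by
    rintro rfl
    exact h.irrefl _ hA
  unfold Off at hx hy
  have := h.share (h.trans hCx hA)
  grind

lemma eq_of_rel_cx_bx_of_rel_cx_ax (h : IsAnchored p a b c) {x y : Fin n} (hx : Off a b c x)
    (hy : Off a b c y) (hDx : p s(c, x) s(b, x)) (hCy : p s(c, y) s(a, y)) : y = x :=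
  h.flip.eq_of_rel_cx_bx_of_rel_ax_bx (x := x) (y := y) ⟨hx.1, hx.2.2, hx.2.1⟩
    ⟨hy.1, hy.2.2, hy.2.1⟩ hDx hCy

lemma exists_off_ne (hn : 5 ≤ n) (a b c x : Fin n) : ∃ e, Off a b c e ∧ e ≠ x := by
  have hlt : ({a, b, c, x} : Finset (Fin n)).card < (Finset.univ : Finset (Fin n)).card := by
    rw [Finset.card_fin]
    exact Finset.card_le_four.trans_lt hn
  obtain ⟨e, -, he⟩ := Finset.exists_mem_notMem_of_card_lt_card hlt
  simp only [Finset.mem_insert, Finset.mem_singleton, not_or] at he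
  exact ⟨e, ⟨he.1, he.2.1, he.2.2.1⟩, he.2.2.2⟩

lemma covered_of_rel_cb_bx (h : IsAnchored p a b c) (hn : 5 ≤ n) {y : Fin n}
    (hy : Off a b c y) (hWy : p s(c, b) s(b, y)) : Covered p := by
  by_cases hA : ∃ z w, Off a b c z ∧ Off a b c w ∧ p s(a, z) s(a, w)
  · obtain ⟨z, w, hz, hw, hA⟩ := hA
    obtain ⟨rfl, hB⟩ := h.eq_of_rel_cb_bx_of_rel_ax_ay hy hz hw hWy hA
    obtain ⟨e, he⟩ := exists_off_ne hn a b c z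
    refine h.covered_formC hz he ?_ ?_ ?_ ?_ ?_ ?_
    · exact fun s t hs ht hst => .inl (h.eq_of_rel_cb_bx_of_rel_ax_ay hz hs ht hWy hst).1
    · exact fun s hs hBs => h.eq_of_rel_ax_bx hs hz hBs hB
    · intro s hs hC
      obtain ⟨rfl, -⟩ := h.eq_of_rel_cb_bx_of_rel_cx_ax hz hs hWy hC
      exact h.not_rel_ax_ay_of_rel_cx_ax hs hw hC hA
    · exact fun s hs hD => (h.eq_of_rel_cx_bx_of_rel_ax_bx hs hz hD hB).symm
    · intro s hs hU
      obtain rfl := h.eq_of_rel_cx_cb_of_rel_cb_bx hs hz hU hWy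
      have hzw : ¬ s = w := by
        rintro rfl
        exact h.irrefl _ hA
      have hac := h.ne_ac
      have hab := h.ne_ab
      unfold Off at hs hw
      rcases h.ferrers hU hA with h' | h' <;> have := h.share h' <;> grind
    · exact fun s hs hW => (h.eq_of_rel_cb_bx_of_rel_ax_ay hs hz hw hW hA).1.symm
  push Not at hA
  by_cases hD : ∃ x, Off a b c x ∧ p s(c, x) s(b, x)
  · obtain ⟨x, hx, hD⟩ := hD
    obtain ⟨e, he⟩ := exists_off_ne hn a b c x
    have hB : ∀ s, Off a b c s → p s(a, s) s(b, s) → s = x :=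
      fun s hs hB => h.eq_of_rel_cx_bx_of_rel_ax_bx hx hs hD hB
    have hC : ∀ s, Off a b c s → p s(c, s) s(a, s) → s = x :=
      fun s hs hC => h.eq_of_rel_cx_bx_of_rel_cx_ax hx hs hD hC
    have hD' : ∀ s, Off a b c s → p s(c, s) s(b, s) → s = x :=
      fun s hs hDs => h.eq_of_rel_cx_bx hs hx hDs hD
    by_cases hyx : ∃ y, Off a b c y ∧ p s(c, b) s(b, y) ∧ y ≠ x
    · obtain ⟨y, hy, hWy, hyx⟩ := hyx
      refine h.covered_formC' hx he hA hB ?_ hD' ?_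
      · intro s hs hCs
        exact hyx ((h.eq_of_rel_cb_bx_of_rel_cx_ax hy hs hWy hCs).1.symm.trans (hC s hs hCs))
      · intro s hs hU
        obtain rfl := h.eq_of_rel_cx_cb_of_rel_cb_bx hs hy hU hWy
        exact hyx (hD' s hs (h.trans hU hWy))
    · push Not at hyx
      obtain rfl := hyx y hy hWy
      exact h.covered_formB hx he hA hB hC hD'
        (fun s hs hU => h.eq_of_rel_cx_cb_of_rel_cb_bx hs hx hU hWy) hyx
  · push Not at hD
    obtain ⟨x, hx, hB⟩ : ∃ x, Off a b c x ∧ ∀ s, Off a b c s → p s(a, s) s(b, s) → s = x := by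
      by_cases hB : ∃ x, Off a b c x ∧ p s(a, x) s(b, x)
      · obtain ⟨x, hx, hB⟩ := hB
        exact ⟨x, hx, fun s hs hBs => h.eq_of_rel_ax_bx hs hx hBs hB⟩
      · push Not at hB
        exact ⟨y, hy, fun s hs hBs => absurd hBs (hB s hs)⟩
    obtain ⟨e, he⟩ := exists_off_ne hn a b c x
    refine h.covered_formC' hx he hA hB ?_ (fun s hs hDs => absurd hDs (hD s hs)) ?_
    · exact fun s hs hC => hD y hy (h.eq_of_rel_cb_bx_of_rel_cx_ax hy hs hWy hC).2
    · intro s hs hU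
      obtain rfl := h.eq_of_rel_cx_cb_of_rel_cb_bx hs hy hU hWy
      exact hD s hs (h.trans hU hWy)

lemma covered_of_not_rel_cx_ax (h : IsAnchored p a b c) (hn : 5 ≤ n) {x : Fin n}
    (hx : Off a b c x) (hD : p s(c, x) s(b, x)) (hC : ¬ p s(c, x) s(a, x))
    (hU : ∀ z, Off a b c z → ¬ p s(c, z) s(c, b))
    (hW : ∀ z, Off a b c z → ¬ p s(c, b) s(b, z)) : Covered p := by
  obtain ⟨e, he⟩ := exists_off_ne hn a b c x
  refine h.covered_formC hx he ?_ ?_ ?_ ?_ hU (fun z hz hWz => absurd hWz (hW z hz))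
  · exact fun s t hs ht hA => h.eq_or_eq_of_rel_cx_bx_of_rel_ax_ay hx hs ht hD hA
  · exact fun s hs hB => h.eq_of_rel_cx_bx_of_rel_ax_bx hx hs hD hB
  · intro s hs hCs
    obtain rfl := h.eq_of_rel_cx_bx_of_rel_cx_ax hx hs hD hCs
    exact hC hCs
  · exact fun s hs hDs => h.eq_of_rel_cx_bx hs hx hDs hD

lemma covered (h : IsAnchored p a b c) (hn : 5 ≤ n) : Covered p := by
  have hoff : ∀ z, Off a b c z → Off a c b z := fun z hz => ⟨hz.1, hz.2.2, hz.2.1⟩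
  have hoff' : ∀ z, Off a c b z → Off a b c z := fun z hz => ⟨hz.1, hz.2.2, hz.2.1⟩
  by_cases hW : ∃ y, Off a b c y ∧ p s(c, b) s(b, y)
  · obtain ⟨y, hy, hW⟩ := hW
    exact h.covered_of_rel_cb_bx hn hy hW
  by_cases hU : ∃ y, Off a b c y ∧ p s(c, y) s(c, b)
  · obtain ⟨y, hy, hU⟩ := hU
    rw [Sym2.eq_swap (a := c) (b := b)] at hU
    exact .of_flip (h.flip.covered_of_rel_cb_bx hn (hoff y hy) hU)
  push Not at hW hU
  by_cases hD : ∃ x, Off a b c x ∧ p s(c, x) s(b, x)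
  · obtain ⟨x, hx, hD⟩ := hD
    by_cases hC : p s(c, x) s(a, x)
    swap
    · exact h.covered_of_not_rel_cx_ax hn hx hD hC hU hW
    by_cases hB : p s(a, x) s(b, x)
    swap
    · refine .of_flip (h.flip.covered_of_not_rel_cx_ax hn (hoff x hx) hD hB ?_ ?_) <;>
        rw [Sym2.eq_swap (a := b) (b := c)]
      · exact fun z hz => hW z (hoff' z hz)
      · exact fun z hz => hU z (hoff' z hz)
    obtain ⟨e, he⟩ := exists_off_ne hn a b c x
    refine h.covered_formB hx he ?_ ?_ ?_ ?_ (fun z hz hUz => absurd hUz (hU z hz))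
      (fun z hz hWz => absurd hWz (hW z hz))
    · intro s t hs ht hA
      rcases h.eq_or_eq_of_rel_cx_bx_of_rel_ax_ay hx hs ht hD hA with rfl | rfl
      · exact h.not_rel_ax_ay_of_rel_cx_ax hx ht hC hA
      · exact h.flip.not_rel_ax_ay_of_rel_cx_ax (hoff _ hx) (hoff _ hs) hB hA
    · exact fun s hs hB => h.eq_of_rel_cx_bx_of_rel_ax_bx hx hs hD hB
    · exact fun s hs hC => h.eq_of_rel_cx_bx_of_rel_cx_ax hx hs hD hC
    · exact fun s hs hDs => h.eq_of_rel_cx_bx hs hx hDs hD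
  push Not at hD
  by_cases hB : ∃ x, Off a b c x ∧ p s(a, x) s(b, x)
  · obtain ⟨x, hx, hB⟩ := hB
    have hBx : ∀ s, Off a b c s → p s(a, s) s(b, s) → s = x :=
      fun s hs hBs => h.eq_of_rel_ax_bx hs hx hBs hB
    by_cases hC : ∃ y, Off a b c y ∧ p s(c, y) s(a, y)
    · obtain ⟨y, hy, hC⟩ := hC
      refine h.covered_formA hx hy ?_ hBx ?_ hD hU hW
      · rintro rfl
        exact hD x hx (h.trans hC hB)
      · exact fun s hs hCs => h.flip.eq_of_rel_ax_bx (hoff s hs) (hoff y hy) hCs hC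
    · push Not at hC
      obtain ⟨y, hy, hyx⟩ := exists_off_ne hn a b c x
      exact h.covered_formA hx hy hyx.symm hBx (fun s hs hCs => absurd hCs (hC s hs)) hD hU hW
  · push Not at hB
    obtain ⟨y, hy, hC⟩ : ∃ y, Off a b c y ∧ ∀ s, Off a b c s → p s(c, s) s(a, s) → s = y := by
      by_cases hC : ∃ y, Off a b c y ∧ p s(c, y) s(a, y)
      · obtain ⟨y, hy, hC⟩ := hC
        exact ⟨y, hy, fun s hs hCs => h.flip.eq_of_rel_ax_bx (hoff s hs) (hoff y hy) hCs hC⟩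
      · push Not at hC
        obtain ⟨y, hy, -⟩ := exists_off_ne hn a b c a
        exact ⟨y, hy, fun s hs hCs => absurd hCs (hC s hs)⟩
    obtain ⟨x, hx, hxy⟩ := exists_off_ne hn a b c y
    exact h.covered_formA hx hy hxy (fun s hs hBs => absurd hBs (hB s hs)) hC hD hU hW

end IsAnchored

/-- Every interval-order subgraph of `L(K_n)` is contained in a graph of
one of the forms (a), (b), (c). -/
lemma exists_form_ge (hn : 5 ≤ n) {H : SimpleGraph (EKn n)}
    (hH : H ≤ (⊤ : SimpleGraph (Fin n)).lineGraph) (hI : H.IsIntervalOrderGraph) :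
    ∃ a b c d e : Fin n, [a, b, c, d, e].Nodup ∧ ∃ G : SimpleGraph (EKn n),
      (G = formA a b c d e ∨ G = formB a b c d ∨ G = formC a b c d ∨ G = formC' a b c d) ∧
      H ≤ G := by
  obtain ⟨I, hI, hadj⟩ := hI
  choose l r hlr hI using hI
  have hadj' : ∀ e f, H.Adj e f ↔ e ≠ f ∧ (r e < l f ∨ r f < l e) := by
    intro e f
    by_cases hef : e = f
    · subst hef
      simp
    have := hadj e f hef
    rw [SimpleGraph.compl_adj, hI, hI, Set.Icc_inter_Icc, Set.nonempty_Icc] at this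
    have he := hlr e
    have hf := hlr f
    simp only [sup_le_iff, le_inf_iff] at this
    grind
  let p : Sym2 (Fin n) → Sym2 (Fin n) → Prop := fun z w =>
    ∃ hz hw, r ⟨z, hz⟩ < l ⟨w, hw⟩
  have hp : IsSharingOrder p := by
    refine ⟨?_, ?_, ?_, ?_⟩
    · rintro u v x y ⟨hz, hw, -⟩
      exact ⟨hz, hw⟩
    · rintro z ⟨hz, hw, h⟩
      exact (hlr _).not_gt h
    · rintro z w z' w' ⟨hz, hw, h⟩ ⟨hz', hw', h'⟩
      rcases lt_or_ge (r ⟨z, hz⟩) (l ⟨w', hw'⟩) with h'' | h''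
      · exact .inl ⟨hz, hw', h''⟩
      · exact .inr ⟨hz', hw, (h'.trans_le h'').trans h⟩
    · rintro u v x y ⟨hz, hw, h⟩
      have hne : (⟨s(u, v), hz⟩ : EKn n) ≠ ⟨s(x, y), hw⟩ := by
        intro h'
        rw [h'] at h
        exact (hlr _).not_gt h
      obtain ⟨t, ht, ht'⟩ := (hH ((hadj' _ _).2 ⟨hne, .inl h⟩)).2
      simp only [SetLike.mem_coe, Sym2.mem_iff] at ht ht'
      grind
  have hcov : Covered p := by
    by_cases hemp : ∃ z w, p z w
    · obtain ⟨z, w, hz, hw, hzw⟩ := hemp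
      have : Nonempty (EKn n) := ⟨⟨z, hz⟩⟩
      obtain ⟨⟨s, hs⟩, hmin⟩ := Finite.exists_min r
      obtain ⟨⟨t, ht⟩, hmax⟩ := Finite.exists_max l
      have hst : p s t := ⟨hs, ht, (hmin _).trans_lt (hzw.trans_le (hmax _))⟩
      have key : ∀ a b c, s = s(a, b) → t = s(a, c) → Covered p := by
        rintro a b c rfl rfl
        refine IsAnchored.covered (a := a) (b := b) (c := c) ⟨hp, hs, ht, ?_, ?_, ?_⟩ hn
        · rintro rfl
          exact hp.irrefl _ hst
        · rintro z w ⟨hz, hw, h⟩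
          exact ⟨hs, hw, (hmin _).trans_lt h⟩
        · rintro z w ⟨hz, hw, h⟩
          exact ⟨hz, ht, h.trans_le (hmax _)⟩
      induction s with | h u v =>
      induction t with | h x y =>
      rcases hp.share hst with rfl | rfl | rfl | rfl
      exacts [key _ _ _ rfl rfl, key _ _ _ rfl Sym2.eq_swap, key _ _ _ Sym2.eq_swap rfl,
        key _ _ _ Sym2.eq_swap Sym2.eq_swap]
    · push Not at hemp
      refine ⟨⟨0, by omega⟩, ⟨1, by omega⟩, ⟨2, by omega⟩, ⟨3, by omega⟩, ⟨4, by omega⟩, by simp,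
        _, .inl rfl, fun z w hzw => absurd hzw (hemp z w)⟩
  obtain ⟨a, b, c, d, e, hnd, G, hG, hpG⟩ := hcov
  refine ⟨a, b, c, d, e, hnd, G, hG, fun z w hzw => ?_⟩
  rcases ((hadj' z w).1 hzw).2 with h | h
  · exact hpG z w ⟨z.2, w.2, h⟩
  · exact (hpG w z ⟨w.2, z.2, h⟩).symm

/-- Every maximal interval-order subgraph of `L(K_n)` (`n ≥ 5`) has edge set of one of the forms
(a) `Q_a ∪ δ_{ab} ∪ δ_{ad} ∪ K_{a,b,c} ∪ K_{a,d,e}`, (b) `δ_{ab} ∪ δ_{ad} ∪ K_{a,b,c,d}`, or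
(c) `δ_{ab} ∪ δ_{ad} ∪ δ_{ac⁻} ∪ K_{a,b,c} ∪ K_{a,b,d} ∪ K_{a,d,c⁻} ∪ K_{b,c,d⁻}` (or the same
set with `δ_{ad}` replaced by `δ_{bc}`), for distinct vertices `a,b,c,d,e` of `K_n`. -/
theorem maximal_intervalOrder_subgraph_lineGraph_complete (hn : 5 ≤ n)
    (H : SimpleGraph (EKn n))
    (hH : Maximal (fun H' : SimpleGraph (EKn n) =>
      H' ≤ (⊤ : SimpleGraph (Fin n)).lineGraph ∧ H'.IsIntervalOrderGraph) H) :
    ∃ a b c d e : Fin n, ([a, b, c, d, e] : List (Fin n)).Nodup ∧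
      (H = Q a ⊔ delta a b ⊔ delta a d ⊔ KU {a, b, c} ⊔ KU {a, d, e} ∨
       H = delta a b ⊔ delta a d ⊔ KU {a, b, c, d} ∨
       H = delta a b ⊔ delta a d ⊔ deltaMinus a c ⊔ KU {a, b, c} ⊔ KU {a, b, d} ⊔
             Ktri a d c ⊔ Ktri b c d ∨
       H = delta a b ⊔ delta b c ⊔ deltaMinus a c ⊔ KU {a, b, c} ⊔ KU {a, b, d} ⊔
             Ktri a d c ⊔ Ktri b c d) := by
  obtain ⟨a, b, c, d, e, hnd, G, hG, hHG⟩ := exists_form_ge hn hH.1.1 hH.1.2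
  have hnd' : [a, b, c, d].Nodup := hnd.sublist (by simp)
  refine ⟨a, b, c, d, e, hnd, ?_⟩
  rcases hG with rfl | rfl | rfl | rfl
  · exact .inl (eq_formA hH hnd hHG)
  · exact .inr (.inl (eq_formB hH hnd' hHG))
  · exact .inr (.inr (.inl (eq_formC hH hnd' hHG)))
  · exact .inr (.inr (.inr (eq_formC' hH hnd' hHG)))

end LineGraphComplete
end

section
/- Let n ≥ 5. Every maximal interval-order subgraph of the line graph L(K_n) has exactly (n+2)(n−1)/2 edges, or exactly 4(n−1) edges, or exactly 5(n−2) edges. -/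
namespace SimpleGraph

/-- A relation is free of `2 + 2` if any two related pairs are linked by a cross relation. -/
def TwoPlusTwoFree {α : Type*} (D : α → α → Prop) : Prop :=
  ∀ ⦃u v u' v'⦄, D u v → D u' v' → D u v' ∨ D u' v

theorem isIntervalOrderGraph_of_twoPlusTwoFree {V : Type*} [Finite V] {F : SimpleGraph V}
    {D : V → V → Prop} (irrefl : ∀ v, ¬ D v v) (free : TwoPlusTwoFree D)
    (adj : ∀ u v, F.Adj u v ↔ D u v ∨ D v u) : F.IsIntervalOrderGraph := by
  classical
  have := Fintype.ofFinite V
  let β : V → ℕ := fun v => (Finset.univ.filter fun u => D u v).card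
  have key : ∀ u, ∃ a : ℕ, ∀ v, D u v ↔ a ≤ β v := by
    intro u
    by_cases hu : ∃ v, D u v
    · obtain ⟨w, hw, hmin⟩ := Finset.exists_min_image (Finset.univ.filter fun v => D u v) β
        (by simpa [Finset.filter_nonempty_iff] using hu)
      simp only [Finset.mem_filter, Finset.mem_univ, true_and] at hw hmin
      refine ⟨β w, fun v => ⟨hmin v, fun hle => ?_⟩⟩
      by_contra hv
      have hss : (Finset.univ.filter fun u => D u v) ⊂ (Finset.univ.filter fun u => D u w) := by
        refine (Finset.ssubset_iff_of_subset fun u' hu' => ?_).2 ⟨u, by simpa, by simpa⟩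
        simp only [Finset.mem_filter, Finset.mem_univ, true_and] at hu' ⊢
        exact (free hw hu').resolve_left hv
      exact absurd (Finset.card_lt_card hss) (not_lt.2 hle)
    · push Not at hu
      refine ⟨Fintype.card V + 1, fun v => iff_of_false (hu v) ?_⟩
      have : β v ≤ Fintype.card V := Finset.card_le_univ _
      omega
  choose a ha using key
  have hβ : ∀ v, β v < a v := fun v => not_le.1 fun h => irrefl v ((ha v v).2 h)
  refine ⟨fun v => Set.Icc (β v : ℝ) ((a v : ℝ) - 1), fun v => ⟨_, _, ?_, rfl⟩, fun u v huv => ?_⟩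
  · have : ((β v + 1 : ℕ) : ℝ) ≤ a v := by exact_mod_cast hβ v
    push_cast at this
    linarith
  · have cast : ∀ u v, (β v : ℝ) ≤ (a u : ℝ) - 1 ↔ ¬ D u v := by
      intro u v
      rw [ha, not_le, le_sub_iff_add_le]
      exact_mod_cast Iff.rfl
    have cast' : ∀ v, (β v : ℝ) ≤ (a v : ℝ) - 1 := fun v => (cast v v).2 (irrefl v)
    rw [compl_adj, adj, Set.Icc_inter_Icc, Set.nonempty_Icc, sup_le_iff, le_inf_iff, le_inf_iff,
      cast, cast, cast, cast]
    have := irrefl u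
    have := irrefl v
    tauto

theorem IsIntervalOrderGraph.exists_rel {V : Type*} [Finite V] {H : SimpleGraph V}
    (hH : H.IsIntervalOrderGraph) :
    ∃ D : V → V → Prop, TwoPlusTwoFree D ∧ (∀ u v, H.Adj u v ↔ D u v ∨ D v u) ∧
      ∀ u v, D u v → ∃ x y, ∀ u v, D u v → D x v ∧ D u y := by
  obtain ⟨I, hI, hadj⟩ := hH
  choose a b hab hI using hI
  refine ⟨fun u v => b u < a v, fun u v u' v' h h' => ?_, fun u v => ?_, fun u v _ => ?_⟩
  · rcases lt_or_ge (b u) (a v') with h1 | h1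
    · exact Or.inl h1
    · exact Or.inr (h'.trans_le (h1.trans h.le))
  · by_cases huv : u = v
    · subst huv
      simp [hab]
    · have := hadj u v huv
      rw [compl_adj, hI, hI, Set.Icc_inter_Icc, Set.nonempty_Icc, sup_le_iff, le_inf_iff,
        le_inf_iff] at this
      have h1 := hab u
      have h2 := hab v
      change H.Adj u v ↔ b u < a v ∨ b v < a u
      rw [← not_le, ← not_le]
      tauto
  · have : Nonempty V := ⟨u⟩
    obtain ⟨x, hx⟩ := Finite.exists_min b
    obtain ⟨y, hy⟩ := Finite.exists_max a
    exact ⟨x, y, fun u v h => ⟨(hx u).trans_lt h, h.trans_le (hy v)⟩⟩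

end SimpleGraph

/-- Two elements of `Sym2 α`, viewed as edges of the complete graph, are distinct and incident. -/
def Sym2.Meets {α : Type*} (e f : Sym2 α) : Prop :=
  ¬ e.IsDiag ∧ ¬ f.IsDiag ∧ e ≠ f ∧ ∃ a, a ∈ e ∧ a ∈ f

theorem Sym2.meets_mk {α : Type*} (a b c d : α) :
    s(a, b).Meets s(c, d) ↔ a ≠ b ∧ c ≠ d ∧ s(a, b) ≠ s(c, d) ∧
      (a = c ∨ a = d ∨ b = c ∨ b = d) := by
  simp only [Sym2.Meets, Sym2.mk_isDiag_iff, Sym2.mem_iff, or_and_right, exists_or,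
    exists_eq_left, or_assoc]

theorem Sym2.Meets.symm {α : Type*} {e f : Sym2 α} (h : e.Meets f) : f.Meets e :=
  ⟨h.2.1, h.1, h.2.2.1.symm, h.2.2.2.imp fun _ => And.symm⟩

namespace SimpleGraph

variable {n : ℕ}

theorem lineGraph_top_adj_iff (u v : (⊤ : SimpleGraph (Fin n)).edgeSet) :
    (⊤ : SimpleGraph (Fin n)).lineGraph.Adj u v ↔ u.1.Meets v.1 := by
  obtain ⟨u, hu⟩ := u
  obtain ⟨v, hv⟩ := v
  have hu' : ¬ u.IsDiag := by simpa using hu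
  have hv' : ¬ v.IsDiag := by simpa using hv
  simp [lineGraph, Sym2.Meets, hu', hv', Set.Nonempty]

open Classical in
theorem card_filter_meets (a b : Fin n) (hab : a ≠ b) :
    (Finset.univ.filter fun e => s(a, b).Meets e).card = 2 * (n - 2) := by
  have hcard : (Finset.univ \ {a, b} : Finset (Fin n)).card = n - 2 := by
    rw [Finset.card_univ_sdiff, Finset.card_pair hab, Fintype.card_fin]
  have : (Finset.univ.filter fun e => s(a, b).Meets e) =
      (Finset.univ \ {a, b}).image (fun z => s(a, z)) ∪
        (Finset.univ \ {a, b}).image (fun z => s(b, z)) := by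
    ext e
    induction e with | _ c d
    simp only [Finset.mem_filter, Finset.mem_univ, true_and, Sym2.meets_mk, Finset.mem_union,
      Finset.mem_image, Finset.mem_sdiff, Finset.mem_insert, Finset.mem_singleton, Sym2.eq_iff]
    constructor
    · rintro ⟨-, hcd, hne, rfl | rfl | rfl | rfl⟩
      · exact Or.inl ⟨d, by grind⟩
      · exact Or.inl ⟨c, by grind⟩
      · exact Or.inr ⟨d, by grind⟩
      · exact Or.inr ⟨c, by grind⟩
    · rintro (⟨z, hz, ⟨rfl, rfl⟩ | ⟨rfl, rfl⟩⟩ | ⟨z, hz, ⟨rfl, rfl⟩ | ⟨rfl, rfl⟩⟩) <;> grind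
  rw [this, Finset.card_union_of_disjoint, Finset.card_image_of_injective,
    Finset.card_image_of_injective, hcard, two_mul]
  · exact fun z w => Sym2.congr_right.1
  · exact fun z w => Sym2.congr_right.1
  · rw [Finset.disjoint_left]
    simp only [Finset.mem_image, Finset.mem_sdiff, Finset.mem_insert, Finset.mem_singleton]
    rintro e ⟨z, hz, rfl⟩ ⟨w, hw, h⟩
    rw [Sym2.eq_iff] at h
    tauto

open Classical in
/-- Two full stars in `L(K_n)` centred at `s(c, p)` and `s(c, q)`, together with a set `R` of pairs
avoiding the two centres, form an interval-order graph if `R` is free of `2 + 2`; if it contains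
the maximal graph `H`, it determines the number of edges of `H`. -/
theorem ncard_edgeSet_of_maximal {H : SimpleGraph (⊤ : SimpleGraph (Fin n)).edgeSet}
    (hH : Maximal (fun H' : SimpleGraph (⊤ : SimpleGraph (Fin n)).edgeSet =>
      H' ≤ (⊤ : SimpleGraph (Fin n)).lineGraph ∧ H'.IsIntervalOrderGraph) H)
    {c p q : Fin n} (hcp : c ≠ p) (hcq : c ≠ q) (hpq : p ≠ q)
    {R : Finset (Sym2 (Fin n) × Sym2 (Fin n))}
    (hR : ∀ u v, (u, v) ∈ R →
      u ≠ s(c, p) ∧ v ≠ s(c, q) ∧ s(c, p).Meets v ∧ u.Meets s(c, q) ∧ u.Meets v)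
    (free : TwoPlusTwoFree fun u v => (u, v) ∈ R)
    (hHR : ∀ u v, H.Adj u v → u.1 = s(c, p) ∨ v.1 = s(c, p) ∨ u.1 = s(c, q) ∨ v.1 = s(c, q) ∨
      (u.1, v.1) ∈ R ∨ (v.1, u.1) ∈ R) :
    H.edgeSet.ncard = 4 * (n - 2) - 1 + R.card := by
  set x := s(c, p) with hx
  set y := s(c, q) with hy
  have hxy : x.Meets y := by simp only [hx, hy, Sym2.meets_mk]; grind
  let X : Finset (Sym2 (Fin n)) := Finset.univ.filter fun e => x.Meets e
  let Y : Finset (Sym2 (Fin n)) := (Finset.univ.filter fun e => y.Meets e).erase x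
  let T : Finset (Sym2 (Fin n) × Sym2 (Fin n)) := ({x} ×ˢ X) ∪ ((Y ×ˢ {y}) ∪ R)
  have hT : ∀ u v, (u, v) ∈ T ↔ (u = x ∧ x.Meets v) ∨ (v = y ∧ u ≠ x ∧ y.Meets u) ∨ (u, v) ∈ R := by
    intro u v
    simp [T, X, Y]
    tauto
  have hTcard : T.card = 4 * (n - 2) - 1 + R.card := by
    have hX : X.card = 2 * (n - 2) := card_filter_meets c p hcp
    have hY : Y.card = 2 * (n - 2) - 1 := by
      rw [Finset.card_erase_of_mem (by simpa using hxy.symm), card_filter_meets c q hcq]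
    rw [Finset.card_union_of_disjoint, Finset.card_union_of_disjoint, Finset.card_product,
      Finset.card_product, hX, hY]
    · simp; omega
    · rw [Finset.disjoint_left]
      rintro ⟨u, v⟩ h h'
      simp only [Finset.mem_product, Finset.mem_singleton] at h
      exact (hR u v h').2.1 h.2
    · rw [Finset.disjoint_left]
      rintro ⟨u, v⟩ h h'
      simp only [Finset.mem_product, Finset.mem_singleton] at h
      simp only [Finset.mem_union, Finset.mem_product, Y, Finset.mem_erase] at h'
      rcases h' with h' | h'
      · exact h'.1.1 h.1
      · exact (hR u v h').1 h.1
  have hTmeets : ∀ u v, (u, v) ∈ T → u.Meets v := by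
    intro u v h
    rcases (hT u v).1 h with ⟨rfl, hx⟩ | ⟨rfl, -, hy⟩ | h
    · exact hx
    · exact hy.symm
    · exact (hR u v h).2.2.2.2
  have hTx : ∀ u v, (u, v) ∈ T → (x, v) ∈ T := by
    intro u v h
    rw [hT]
    rcases (hT u v).1 h with ⟨-, h⟩ | ⟨rfl, -, -⟩ | h
    · exact Or.inl ⟨rfl, h⟩
    · exact Or.inl ⟨rfl, hxy⟩
    · exact Or.inl ⟨rfl, (hR u v h).2.2.1⟩
  have hTy : ∀ u v, (u, v) ∈ T → (u, y) ∈ T := by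
    intro u v h
    rw [hT]
    rcases (hT u v).1 h with ⟨rfl, -⟩ | ⟨-, h', h⟩ | h
    · exact Or.inl ⟨rfl, hxy⟩
    · exact Or.inr (Or.inl ⟨rfl, h', h⟩)
    · exact Or.inr (Or.inl ⟨rfl, (hR u v h).1, (hR u v h).2.2.2.1.symm⟩)
  have hTfree : TwoPlusTwoFree fun u v => (u, v) ∈ T := by
    intro u v u' v' h h'
    rcases (hT u v).1 h with ⟨rfl, -⟩ | ⟨rfl, -, -⟩ | hr
    · exact Or.inl (hTx _ _ h')
    · exact Or.inr (hTy _ _ h')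
    rcases (hT u' v').1 h' with ⟨rfl, -⟩ | ⟨rfl, -, -⟩ | hr'
    · exact Or.inr (hTx _ _ h)
    · exact Or.inl (hTy _ _ h)
    · exact (free hr hr').imp (fun h => (hT _ _).2 (Or.inr (Or.inr h)))
        (fun h => (hT _ _).2 (Or.inr (Or.inr h)))
  have hTirrefl : ∀ u, (u, u) ∉ T := fun u h => (hTmeets u u h).2.2.1 rfl
  let F : SimpleGraph (⊤ : SimpleGraph (Fin n)).edgeSet :=
    { Adj := fun u v => (u.1, v.1) ∈ T ∨ (v.1, u.1) ∈ T
      symm := ⟨fun u v h => h.symm⟩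
      loopless := ⟨fun u h => hTirrefl _ (or_self_iff.1 h)⟩ }
  have hF : F ≤ (⊤ : SimpleGraph (Fin n)).lineGraph ∧ F.IsIntervalOrderGraph := by
    refine ⟨fun u v h => ?_, isIntervalOrderGraph_of_twoPlusTwoFree
      (D := fun u v : (⊤ : SimpleGraph (Fin n)).edgeSet => (u.1, v.1) ∈ T) (fun v => hTirrefl v.1)
      (fun u v u' v' h h' => hTfree h h') fun u v => Iff.rfl⟩
    rw [lineGraph_top_adj_iff]
    exact h.elim (hTmeets _ _) fun h => (hTmeets _ _ h).symm
  have hHF : H ≤ F := by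
    intro u v h
    have huv := (lineGraph_top_adj_iff u v).1 (hH.prop.1 h)
    change (u.1, v.1) ∈ T ∨ (v.1, u.1) ∈ T
    rw [hT, hT]
    have := huv.symm
    have h1 := hHR u v h
    grind
  obtain rfl : H = F := le_antisymm hHF (hH.2 hF hHF)
  rw [← hTcard, ← Set.ncard_coe_finset]
  symm
  have hV : ∀ u v, (u, v) ∈ T → u ∈ (⊤ : SimpleGraph (Fin n)).edgeSet ∧
      v ∈ (⊤ : SimpleGraph (Fin n)).edgeSet := by
    intro u v h
    simpa using And.intro (hTmeets u v h).1 (hTmeets u v h).2.1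
  refine Set.ncard_congr
    (fun e he => s(⟨e.1, (hV _ _ he).1⟩, ⟨e.2, (hV _ _ he).2⟩)) ?_ ?_ ?_
  · rintro ⟨u, v⟩ h
    exact Or.inl h
  · rintro ⟨u, v⟩ ⟨u', v'⟩ h h' heq
    simp only [Sym2.eq_iff, Subtype.mk.injEq] at heq
    rcases heq with ⟨rfl, rfl⟩ | ⟨rfl, rfl⟩
    · rfl
    · exact absurd (hTfree h h') (by simp [hTirrefl])
  · intro e
    induction e with | _ u v
    rintro (h | h)
    · exact ⟨(u.1, v.1), h, rfl⟩
    · exact ⟨(v.1, u.1), h, Sym2.eq_swap⟩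

end SimpleGraph
theorem Sym2.Meets.exists_eq {α : Type*} {e : Sym2 α} {a b : α} (h : e.Meets s(a, b)) :
    ∃ z, z ≠ a ∧ z ≠ b ∧ (e = s(a, z) ∨ e = s(b, z)) := by
  induction e with | _ c d
  rw [Sym2.meets_mk] at h
  obtain ⟨hcd, hab, hne, rfl | rfl | rfl | rfl⟩ := h
  · exact ⟨d, by grind⟩
  · exact ⟨d, by grind⟩
  · exact ⟨c, by grind⟩
  · exact ⟨c, by grind⟩

namespace SimpleGraph

variable {n : ℕ}

/-- The vertices of `K_n` outside a given triple. -/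
def outside (c p q : Fin n) : Finset (Fin n) := Finset.univ \ {c, p, q}

theorem mem_outside {c p q z : Fin n} : z ∈ outside c p q ↔ z ≠ c ∧ z ≠ p ∧ z ≠ q := by
  simp [outside]

theorem card_outside {c p q : Fin n} (hcp : c ≠ p) (hcq : c ≠ q) (hpq : p ≠ q) :
    (outside c p q).card = n - 3 := by
  rw [outside, Finset.card_univ_sdiff, Fintype.card_fin,
    Finset.card_eq_three.2 ⟨c, p, q, hcp, hcq, hpq, rfl⟩]

/-- The shapes of the incident pairs lying between the extremal elements `s(c, p)` and `s(c, q)`. -/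
theorem residual_pair_cases {c p q : Fin n} (hcp : c ≠ p) (hcq : c ≠ q) (hpq : p ≠ q)
    {u v : Sym2 (Fin n)} (hv : s(c, p).Meets v) (hu : u.Meets s(c, q)) (huv : u.Meets v)
    (hux : u ≠ s(c, p)) (hvy : v ≠ s(c, q)) :
    ∃ z ∈ outside c p q,
      (∃ w ∈ outside c p q, z ≠ w ∧ u = s(c, z) ∧ v = s(c, w)) ∨
      (u = s(c, z) ∧ v = s(p, z)) ∨ (u = s(q, p) ∧ v = s(p, z)) ∨
      (u = s(q, z) ∧ v = s(c, z)) ∨ (u = s(q, z) ∧ v = s(q, p)) ∨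
      (u = s(q, z) ∧ v = s(p, z)) := by
  obtain ⟨z, hzc, hzq, rfl | rfl⟩ := hu.exists_eq <;>
  obtain ⟨w, hwc, hwp, rfl | rfl⟩ := hv.symm.exists_eq <;>
  rw [Sym2.meets_mk] at huv
  · exact ⟨z, mem_outside.2 (by grind), Or.inl ⟨w, mem_outside.2 (by grind), by grind⟩⟩
  · exact ⟨z, mem_outside.2 (by grind), by grind⟩
  · exact ⟨w, mem_outside.2 (by grind), by grind⟩
  · by_cases hzp : z = p
    · exact ⟨w, mem_outside.2 (by grind), by grind⟩
    · exact ⟨z, mem_outside.2 (by grind), by grind⟩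

variable {H : SimpleGraph (⊤ : SimpleGraph (Fin n)).edgeSet}
  (hH : Maximal (fun H' : SimpleGraph (⊤ : SimpleGraph (Fin n)).edgeSet =>
    H' ≤ (⊤ : SimpleGraph (Fin n)).lineGraph ∧ H'.IsIntervalOrderGraph) H)
  {c p q : Fin n} (hcp : c ≠ p) (hcq : c ≠ q) (hpq : p ≠ q)
  {D : Sym2 (Fin n) → Sym2 (Fin n) → Prop} (hadj : ∀ u v, H.Adj u v → D u.1 v.1 ∨ D v.1 u.1)

include hH hcp hcq hpq hadj

/-- If the order underlying `H` embeds into the `2 + 2`-free relation `R` together with all pairs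
through the extremal elements `s(c, p)` and `s(c, q)`, maximality determines the edge count. -/
theorem ncard_edgeSet_of_rel_subset {R : Finset (Sym2 (Fin n) × Sym2 (Fin n))}
    (hR : ∀ u v, (u, v) ∈ R →
      u ≠ s(c, p) ∧ v ≠ s(c, q) ∧ s(c, p).Meets v ∧ u.Meets s(c, q) ∧ u.Meets v)
    (free : TwoPlusTwoFree fun u v => (u, v) ∈ R)
    (hD : ∀ u v, D u v → u = s(c, p) ∨ v = s(c, q) ∨ (u, v) ∈ R) :
    H.edgeSet.ncard = 4 * (n - 2) - 1 + R.card := by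
  refine ncard_edgeSet_of_maximal hH hcp hcq hpq hR free fun u v h => ?_
  rcases hadj u v h with h | h <;> have := hD _ _ h <;> tauto

theorem ncard_edgeSet_of_single {k : Fin n} (hn : 5 ≤ n) (hk : k ∈ outside c p q)
    (hD : ∀ u v, D u v → u = s(c, p) ∨ v = s(c, q) ∨ (u = s(q, k) ∧ v = s(c, k)) ∨
      (u = s(q, k) ∧ v = s(p, k)) ∨ (u = s(q, k) ∧ v = s(q, p)) ∨ (u = s(c, k) ∧ v = s(p, k)) ∨
      (u = s(q, p) ∧ v = s(p, k))) :
    H.edgeSet.ncard = 4 * (n - 1) := by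
  obtain ⟨hkc, hkp, hkq⟩ := mem_outside.1 hk
  let R : Finset (Sym2 (Fin n) × Sym2 (Fin n)) :=
    {(s(q, k), s(c, k)), (s(q, k), s(p, k)), (s(q, k), s(q, p)), (s(c, k), s(p, k)),
      (s(q, p), s(p, k))}
  have hmem : ∀ u v, (u, v) ∈ R ↔ (u = s(q, k) ∧ v = s(c, k)) ∨
      (u = s(q, k) ∧ v = s(p, k)) ∨ (u = s(q, k) ∧ v = s(q, p)) ∨ (u = s(c, k) ∧ v = s(p, k)) ∨
      (u = s(q, p) ∧ v = s(p, k)) := by simp [R]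
  have hcard : R.card = 5 := by
    simp only [R]
    repeat rw [Finset.card_insert_of_notMem
      (by simp only [Finset.mem_insert, Finset.mem_singleton, Prod.mk.injEq]; grind)]
    simp
  rw [ncard_edgeSet_of_rel_subset hH hcp hcq hpq hadj (R := R), hcard]
  · omega
  · intro u v h
    rw [hmem] at h
    rcases h with ⟨rfl, rfl⟩ | ⟨rfl, rfl⟩ | ⟨rfl, rfl⟩ | ⟨rfl, rfl⟩ | ⟨rfl, rfl⟩ <;>
      simp only [Sym2.meets_mk, ne_eq, Sym2.eq_iff] <;> clear hcard hmem hD <;> grind only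
  · intro u v u' v' h h'
    simp only [hmem] at h h' ⊢
    rcases h with ⟨rfl, rfl⟩ | ⟨rfl, rfl⟩ | ⟨rfl, rfl⟩ | ⟨rfl, rfl⟩ | ⟨rfl, rfl⟩ <;>
      rcases h' with ⟨rfl, rfl⟩ | ⟨rfl, rfl⟩ | ⟨rfl, rfl⟩ | ⟨rfl, rfl⟩ | ⟨rfl, rfl⟩ <;> simp
  · intro u v h
    rw [hmem]
    exact hD u v h

theorem ncard_edgeSet_of_fan_center {k : Fin n} (hn : 5 ≤ n) (hk : k ∈ outside c p q)
    (hD : ∀ u v, D u v → u = s(c, p) ∨ v = s(c, q) ∨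
      (∃ z ∈ outside c p q, z ≠ k ∧ u = s(c, z) ∧ v = s(c, k)) ∨ (u = s(q, k) ∧ v = s(c, k)) ∨
      (u = s(q, k) ∧ v = s(p, k)) ∨ (u = s(q, k) ∧ v = s(q, p))) :
    H.edgeSet.ncard = 5 * (n - 2) := by
  obtain ⟨hkc, hkp, hkq⟩ := mem_outside.1 hk
  let R : Finset (Sym2 (Fin n) × Sym2 (Fin n)) :=
    ((outside c p q).erase k).image (fun z => (s(c, z), s(c, k))) ∪
      {(s(q, k), s(c, k)), (s(q, k), s(p, k)), (s(q, k), s(q, p))}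
  have hmem : ∀ u v, (u, v) ∈ R ↔ (∃ z ∈ outside c p q, z ≠ k ∧ u = s(c, z) ∧ v = s(c, k)) ∨
      (u = s(q, k) ∧ v = s(c, k)) ∨ (u = s(q, k) ∧ v = s(p, k)) ∨
      (u = s(q, k) ∧ v = s(q, p)) := by
    intro u v
    simp only [R, Finset.mem_union, Finset.mem_image, Finset.mem_erase, Prod.mk.injEq,
      Finset.mem_insert, Finset.mem_singleton, and_assoc, eq_comm (b := u), eq_comm (b := v),
      and_left_comm (a := _ ≠ k)]
  have hcard : R.card = n - 4 + 3 := by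
    rw [Finset.card_union_of_disjoint, Finset.card_image_of_injective, Finset.card_erase_of_mem hk,
      card_outside hcp hcq hpq, Finset.card_eq_three.2 ⟨_, _, _, ?_, ?_, ?_, rfl⟩]
    · omega
    · simp only [ne_eq, Prod.mk.injEq]; grind
    · simp only [ne_eq, Prod.mk.injEq]; grind
    · simp only [ne_eq, Prod.mk.injEq]; grind
    · exact fun z w h => Sym2.congr_right.1 (Prod.ext_iff.1 h).1
    · rw [Finset.disjoint_left]
      simp only [Finset.mem_image, Finset.mem_erase, Finset.mem_insert, Finset.mem_singleton]
      rintro _ ⟨z, hz, rfl⟩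
      simp only [Prod.mk.injEq]
      grind
  rw [ncard_edgeSet_of_rel_subset hH hcp hcq hpq hadj (R := R), hcard]
  · omega
  · intro u v h
    rw [hmem] at h
    rcases h with ⟨z, hz, hzk, rfl, rfl⟩ | ⟨rfl, rfl⟩ | ⟨rfl, rfl⟩ | ⟨rfl, rfl⟩ <;>
      simp only [Sym2.meets_mk, mem_outside, ne_eq, Sym2.eq_iff] at * <;>
      clear hcard hmem hD <;> grind only
  · intro u v u' v' h h'
    simp only [hmem] at h h' ⊢
    rcases h with ⟨z, hz, hzk, rfl, rfl⟩ | ⟨rfl, rfl⟩ | ⟨rfl, rfl⟩ | ⟨rfl, rfl⟩ <;>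
      rcases h' with ⟨z', hz', hzk', rfl, rfl⟩ | ⟨rfl, rfl⟩ | ⟨rfl, rfl⟩ | ⟨rfl, rfl⟩ <;>
      first | exact Or.inl (Or.inl ⟨_, hz, hzk, rfl, rfl⟩) | simp
  · intro u v h
    rw [hmem]
    exact hD u v h

theorem ncard_edgeSet_of_fan_end {k : Fin n} (hn : 5 ≤ n) (hk : k ∈ outside c p q)
    (hD : ∀ u v, D u v → u = s(c, p) ∨ v = s(c, q) ∨
      (∃ z ∈ outside c p q, u = s(q, z) ∧ v = s(q, p)) ∨ (u = s(q, k) ∧ v = s(c, k)) ∨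
      (u = s(q, k) ∧ v = s(p, k))) :
    H.edgeSet.ncard = 5 * (n - 2) := by
  obtain ⟨hkc, hkp, hkq⟩ := mem_outside.1 hk
  let R : Finset (Sym2 (Fin n) × Sym2 (Fin n)) :=
    (outside c p q).image (fun z => (s(q, z), s(q, p))) ∪
      {(s(q, k), s(c, k)), (s(q, k), s(p, k))}
  have hmem : ∀ u v, (u, v) ∈ R ↔ (∃ z ∈ outside c p q, u = s(q, z) ∧ v = s(q, p)) ∨
      (u = s(q, k) ∧ v = s(c, k)) ∨ (u = s(q, k) ∧ v = s(p, k)) := by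
    intro u v
    simp only [R, Finset.mem_union, Finset.mem_image, Prod.mk.injEq,
      Finset.mem_insert, Finset.mem_singleton, eq_comm (b := u), eq_comm (b := v)]
  have hcard : R.card = n - 3 + 2 := by
    rw [Finset.card_union_of_disjoint, Finset.card_image_of_injective,
      card_outside hcp hcq hpq, Finset.card_pair]
    · simp only [ne_eq, Prod.mk.injEq]; grind
    · exact fun z w h => Sym2.congr_right.1 (Prod.ext_iff.1 h).1
    · rw [Finset.disjoint_left]
      simp only [Finset.mem_image, Finset.mem_insert, Finset.mem_singleton]
      rintro _ ⟨z, hz, rfl⟩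
      simp only [Prod.mk.injEq]
      grind
  rw [ncard_edgeSet_of_rel_subset hH hcp hcq hpq hadj (R := R), hcard]
  · omega
  · intro u v h
    rw [hmem] at h
    rcases h with ⟨z, hz, rfl, rfl⟩ | ⟨rfl, rfl⟩ | ⟨rfl, rfl⟩ <;>
      simp only [Sym2.meets_mk, mem_outside, ne_eq, Sym2.eq_iff] at * <;>
      clear hcard hmem hD <;> grind only
  · intro u v u' v' h h'
    simp only [hmem] at h h' ⊢
    rcases h with ⟨z, hz, rfl, rfl⟩ | ⟨rfl, rfl⟩ | ⟨rfl, rfl⟩ <;>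
      rcases h' with ⟨z', hz', rfl, rfl⟩ | ⟨rfl, rfl⟩ | ⟨rfl, rfl⟩ <;>
      first
        | exact Or.inl (Or.inl ⟨_, hz, rfl, rfl⟩)
        | exact Or.inl (Or.inl ⟨_, hk, rfl, rfl⟩)
        | exact Or.inr (Or.inl ⟨_, hk, rfl, rfl⟩)
        | simp
  · intro u v h
    rw [hmem]
    exact hD u v h

omit hH hcp hcq hpq hadj in
theorem card_filter_lt_of_injOn {α : Type*} [DecidableEq α] (Z : Finset α) (f : α → ℕ)
    (hf : Set.InjOn f Z) :
    ((Z ×ˢ Z).filter fun e => f e.1 < f e.2).card = Z.card.choose 2 := by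
  have hswap : ((Z ×ˢ Z).filter fun e => f e.2 < f e.1).card =
      ((Z ×ˢ Z).filter fun e => f e.1 < f e.2).card := by
    refine Finset.card_bij (fun e _ => e.swap) ?_ ?_ ?_
    · simp; tauto
    · simp
    · simp; tauto
  have hunion : Z.offDiag = ((Z ×ˢ Z).filter fun e => f e.1 < f e.2) ∪
      ((Z ×ˢ Z).filter fun e => f e.2 < f e.1) := by
    ext ⟨a, b⟩
    simp only [Finset.mem_offDiag, Finset.mem_union, Finset.mem_filter, Finset.mem_product]
    constructor
    · rintro ⟨ha, hb, hab⟩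
      have := fun h => hab (hf ha hb h)
      grind
    · grind
  have hcard := congrArg Finset.card hunion
  rw [Finset.card_union_of_disjoint (Finset.disjoint_left.2 (by grind)), hswap,
    Finset.offDiag_card, ← two_mul, ← Nat.mul_sub_one] at hcard
  rw [Nat.choose_two_right, hcard]
  omega

theorem ncard_edgeSet_of_star {a b : Fin n} (hn : 5 ≤ n) (ha : a ∈ outside c p q)
    (hb : b ∈ outside c p q) (hab : a ≠ b)
    (hD : ∀ u v, D u v → u = s(c, p) ∨ v = s(c, q) ∨
      (∃ z ∈ outside c p q, ∃ w ∈ outside c p q, z ≠ w ∧ u = s(c, z) ∧ v = s(c, w)) ∨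
      (u = s(c, a) ∧ v = s(p, a)) ∨ (u = s(q, b) ∧ v = s(c, b))) :
    H.edgeSet.ncard = (n + 2) * (n - 1) / 2 := by
  obtain ⟨f, hf, hfa, hfb⟩ : ∃ f : Fin n → ℕ, Function.Injective f ∧ (∀ z, f a ≤ f z) ∧
      ∀ z, f z ≤ f b := by
    refine ⟨fun z => if z = a then 0 else if z = b then n + 1 else z + 1, fun z w h => ?_,
      fun z => by simp, fun z => ?_⟩
    · simp only at h
      split_ifs at h <;> grind
    · simp only
      split_ifs <;> grind
  let R : Finset (Sym2 (Fin n) × Sym2 (Fin n)) :=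
    ((outside c p q ×ˢ outside c p q).filter fun e => f e.1 < f e.2).image
      (fun e => (s(c, e.1), s(c, e.2))) ∪ {(s(c, a), s(p, a)), (s(q, b), s(c, b))}
  have hmem : ∀ u v, (u, v) ∈ R ↔
      (∃ z ∈ outside c p q, ∃ w ∈ outside c p q, f z < f w ∧ u = s(c, z) ∧ v = s(c, w)) ∨
      (u = s(c, a) ∧ v = s(p, a)) ∨ (u = s(q, b) ∧ v = s(c, b)) := by
    intro u v
    simp only [R, Finset.mem_union, Finset.mem_image, Prod.mk.injEq, Finset.mem_filter,
      Finset.mem_product, Prod.exists,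
      Finset.mem_insert, Finset.mem_singleton, eq_comm (b := u), eq_comm (b := v), and_assoc]
    grind
  have hcard : R.card = (n - 3).choose 2 + 2 := by
    rw [Finset.card_union_of_disjoint, Finset.card_image_of_injective,
      card_filter_lt_of_injOn _ _ hf.injOn, card_outside hcp hcq hpq, Finset.card_pair]
    · simp only [ne_eq, Prod.mk.injEq]; grind [mem_outside]
    · exact fun z w h => Prod.ext (Sym2.congr_right.1 (Prod.ext_iff.1 h).1)
        (Sym2.congr_right.1 (Prod.ext_iff.1 h).2)
    · rw [Finset.disjoint_left]
      simp only [Finset.mem_image, Finset.mem_insert, Finset.mem_singleton, Finset.mem_filter,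
        Finset.mem_product]
      rintro _ ⟨z, hz, rfl⟩
      simp only [Prod.mk.injEq]
      grind [mem_outside]
  rw [ncard_edgeSet_of_maximal hH hcp hcq hpq (R := R), hcard]
  · rw [Nat.choose_two_right]
    obtain ⟨m, rfl⟩ := Nat.exists_eq_add_of_le hn
    rw [show 5 + m - 3 = m + 2 by omega, show m + 2 - 1 = m + 1 by omega,
      show 5 + m - 1 = m + 4 by omega, show 4 * (5 + m - 2) - 1 = 4 * m + 11 by omega]
    have h1 : (5 + m + 2) * (m + 4) = (m + 2) * (m + 1) + 2 * (4 * m + 13) := by ring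
    omega
  · intro u v h
    rw [hmem] at h
    rcases h with ⟨z, hz, w, hw, hzw, rfl, rfl⟩ | ⟨rfl, rfl⟩ | ⟨rfl, rfl⟩ <;>
      simp only [Sym2.meets_mk, mem_outside, ne_eq, Sym2.eq_iff] at * <;>
      clear hcard hmem hD <;> grind only
  · intro u v u' v' h h'
    simp only [hmem] at h h' ⊢
    have hlt : f a < f b := lt_of_le_of_ne (hfa b) fun h => hab (hf h)
    rcases h with ⟨z, hz, w, hw, hzw, rfl, rfl⟩ | ⟨rfl, rfl⟩ | ⟨rfl, rfl⟩ <;>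
      rcases h' with ⟨z', hz', w', hw', hzw', rfl, rfl⟩ | ⟨rfl, rfl⟩ | ⟨rfl, rfl⟩
    · rcases lt_or_ge (f z) (f w') with h | h
      · exact Or.inl (Or.inl ⟨z, hz, w', hw', h, rfl, rfl⟩)
      · exact Or.inr (Or.inl ⟨z', hz', w, hw, by omega, rfl, rfl⟩)
    · exact Or.inr (Or.inl ⟨a, ha, w, hw, (hfa z).trans_lt hzw, rfl, rfl⟩)
    · exact Or.inl (Or.inl ⟨z, hz, b, hb, hzw.trans_le (hfb w), rfl, rfl⟩)
    · exact Or.inl (Or.inl ⟨a, ha, w', hw', (hfa z').trans_lt hzw', rfl, rfl⟩)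
    · exact Or.inl (Or.inr (Or.inl ⟨rfl, rfl⟩))
    · exact Or.inl (Or.inl ⟨a, ha, b, hb, hlt, rfl, rfl⟩)
    · exact Or.inr (Or.inl ⟨z', hz', b, hb, hzw'.trans_le (hfb w'), rfl, rfl⟩)
    · exact Or.inr (Or.inl ⟨a, ha, b, hb, hlt, rfl, rfl⟩)
    · exact Or.inl (Or.inr (Or.inr ⟨rfl, rfl⟩))
  · have key : ∀ u v, D u v → u = s(c, p) ∨ v = s(c, q) ∨ (u, v) ∈ R ∨ (v, u) ∈ R := by
      intro u v h
      rw [hmem, hmem]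
      rcases hD u v h with h | h | ⟨z, hz, w, hw, hzw, rfl, rfl⟩ | h | h
      · exact Or.inl h
      · exact Or.inr (Or.inl h)
      · rcases Nat.lt_or_gt_of_ne (hf.ne hzw) with h | h
        · exact Or.inr (Or.inr (Or.inl (Or.inl ⟨z, hz, w, hw, h, rfl, rfl⟩)))
        · exact Or.inr (Or.inr (Or.inr (Or.inl ⟨w, hw, z, hz, h, rfl, rfl⟩)))
      · exact Or.inr (Or.inr (Or.inl (Or.inr (Or.inl h))))
      · exact Or.inr (Or.inr (Or.inl (Or.inr (Or.inr h))))
    intro u v h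
    rcases hadj u v h with h | h <;> rcases key _ _ h with h | h | h | h
    · exact Or.inl h
    · exact Or.inr (Or.inr (Or.inr (Or.inl h)))
    · exact Or.inr (Or.inr (Or.inr (Or.inr (Or.inl h))))
    · exact Or.inr (Or.inr (Or.inr (Or.inr (Or.inr h))))
    · exact Or.inr (Or.inl h)
    · exact Or.inr (Or.inr (Or.inl h))
    · exact Or.inr (Or.inr (Or.inr (Or.inr (Or.inr h))))
    · exact Or.inr (Or.inr (Or.inr (Or.inr (Or.inl h))))
variable (free : TwoPlusTwoFree D) (hmeets : ∀ ⦃u v⦄, D u v → u.Meets v)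
  (hext : ∀ ⦃u v⦄, D u v → D s(c, p) v ∧ D u s(c, q))

omit hH hadj in
include hmeets hext in
theorem rel_cases {u v : Sym2 (Fin n)} (h : D u v) :
    u = s(c, p) ∨ v = s(c, q) ∨ ∃ z ∈ outside c p q,
      (∃ w ∈ outside c p q, z ≠ w ∧ u = s(c, z) ∧ v = s(c, w)) ∨
      (u = s(c, z) ∧ v = s(p, z)) ∨ (u = s(q, p) ∧ v = s(p, z)) ∨
      (u = s(q, z) ∧ v = s(c, z)) ∨ (u = s(q, z) ∧ v = s(q, p)) ∨
      (u = s(q, z) ∧ v = s(p, z)) := by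
  by_cases hu : u = s(c, p)
  · exact Or.inl hu
  by_cases hv : v = s(c, q)
  · exact Or.inr (Or.inl hv)
  exact Or.inr (Or.inr (residual_pair_cases hcp hcq hpq (hmeets (hext h).1) (hmeets (hext h).2)
    (hmeets h) hu hv))

omit hH hcp hcq hpq hadj in
include hmeets in
theorem rel_mk {a b d e : Fin n} (h : D s(a, b) s(d, e)) :
    a ≠ b ∧ d ≠ e ∧ ¬ (a = d ∧ b = e ∨ a = e ∧ b = d) ∧ (a = d ∨ a = e ∨ b = d ∨ b = e) := by
  simpa only [Sym2.meets_mk, ne_eq, Sym2.eq_iff] using hmeets h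

omit hH hcp hcq hpq hadj in
include free hmeets in
theorem rel_trans {u v w : Sym2 (Fin n)} (h : D u v) (h' : D v w) : D u w :=
  (free h h').resolve_right fun h => (hmeets h).2.2.1 rfl

include free hmeets hext

theorem ncard_edgeSet_of_opposite_of_center {k a : Fin n} (hn : 5 ≤ n) (hk : k ∈ outside c p q)
    (ha : a ∈ outside c p q) (hqk : D s(q, k) s(p, k)) (hak : D s(c, a) s(c, k)) :
    H.edgeSet.ncard = 5 * (n - 2) := by
  refine ncard_edgeSet_of_fan_center hH hcp hcq hpq hadj hn hk fun u v h => ?_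
  have hm := @rel_mk n D hmeets
  have htrans := @rel_trans n D free hmeets
  clear hH hadj
  rcases rel_cases hcp hcq hpq hmeets hext h with hu | hv | ⟨z, hz, hcase⟩
  · exact Or.inl hu
  · exact Or.inr (Or.inl hv)
  clear hext
  have hz' := mem_outside.1 hz
  rw [mem_outside] at hk ha
  have hak' := hm hak
  rcases hcase with ⟨w, hw, hzw, rfl, rfl⟩ | ⟨rfl, rfl⟩ | ⟨rfl, rfl⟩ | ⟨rfl, rfl⟩ | ⟨rfl, rfl⟩ |
    ⟨rfl, rfl⟩
  · have hw' := mem_outside.1 hw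
    have hor : z = k ∨ w = k := by
      rcases free h hqk with h | h <;> have := hm h <;> grind only
    rcases hor with rfl | rfl
    · have h' := htrans hak h
      have := hm h'
      exfalso
      rcases free h' hqk with h | h <;> have := hm h <;> grind only
    · exact Or.inr (Or.inr (Or.inl ⟨z, hz, hzw, rfl, rfl⟩))
  · have hzk : z = k := by
      rcases free h hqk with h | h <;> have := hm h <;> grind only
    subst hzk
    have := hm (htrans hak h)
    grind only
  · exfalso
    have hza : z = a := by
      rcases free hak h with h | h <;> have := hm h <;> grind only
    subst hza
    have h' : D s(c, z) s(p, z) := (free hak h).resolve_right fun h => by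
      have := hm h
      grind only
    rcases free h' hqk with h | h <;> have := hm h <;> grind only
  · have hzk : z = k := by
      rcases free h hqk with h | h <;> have := hm h <;> grind only
    simp [hzk]
  · have hzk : z = k := by
      rcases free h hak with h | h <;> have := hm h <;> grind only
    simp [hzk]
  · have hzk : z = k := by
      rcases free h hqk with h | h <;> have := hm h <;> grind only
    simp [hzk]

theorem ncard_edgeSet_of_opposite_of_end {k a : Fin n} (hn : 5 ≤ n) (hk : k ∈ outside c p q)
    (ha : a ∈ outside c p q) (hak : a ≠ k) (hqk : D s(q, k) s(p, k)) (hqa : D s(q, a) s(q, p)) :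
    H.edgeSet.ncard = 5 * (n - 2) := by
  refine ncard_edgeSet_of_fan_end hH hcp hcq hpq hadj hn hk fun u v h => ?_
  have hm := @rel_mk n D hmeets
  have htrans := @rel_trans n D free hmeets
  clear hH hadj
  rcases rel_cases hcp hcq hpq hmeets hext h with hu | hv | ⟨z, hz, hcase⟩
  · exact Or.inl hu
  · exact Or.inr (Or.inl hv)
  clear hext
  have hz' := mem_outside.1 hz
  rw [mem_outside] at hk ha
  rcases hcase with ⟨w, hw, hzw, rfl, rfl⟩ | ⟨rfl, rfl⟩ | ⟨rfl, rfl⟩ | ⟨rfl, rfl⟩ | ⟨rfl, rfl⟩ |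
    ⟨rfl, rfl⟩
  · exfalso
    have hw' := mem_outside.1 hw
    have h' : D s(q, a) s(c, w) := (free h hqa).resolve_left fun h => by
      have := hm h
      grind only
    have := hm h'
    rcases free h' hqk with h | h <;> have := hm h <;> grind only
  · exfalso
    have hzk : z = k := by
      rcases free h hqk with h | h <;> have := hm h <;> grind only
    rcases free h hqa with h | h <;> have := hm h <;> grind only
  · exfalso
    have h' := htrans hqa h
    have := hm h'
    rcases free h' hqk with h | h <;> have := hm h <;> grind only
  · have hzk : z = k := by
      rcases free h hqk with h | h <;> have := hm h <;> grind only
    simp [hzk]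
  · exact Or.inr (Or.inr (Or.inl ⟨z, hz, rfl, rfl⟩))
  · have hzk : z = k := by
      rcases free h hqk with h | h <;> have := hm h <;> grind only
    simp [hzk]

theorem ncard_edgeSet_of_end {a : Fin n} (hn : 5 ≤ n) (ha : a ∈ outside c p q)
    (hqa : D s(q, a) s(q, p)) (hno : ∀ z, ¬ D s(q, z) s(p, z)) :
    H.edgeSet.ncard = 5 * (n - 2) := by
  have hm := @rel_mk n D hmeets
  have htrans := @rel_trans n D free hmeets
  have ha' := mem_outside.1 ha
  have hII : ∀ z ∈ outside c p q, ¬ D s(c, z) s(p, z) := by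
    intro z hz h
    have hz := mem_outside.1 hz
    clear hH hadj hext
    rcases free h hqa with h | h
    · have := hm h
      grind only
    · have := hm h
      have haz : a = z := by grind only
      exact hno z (haz ▸ h)
  have hIII : ∀ z ∈ outside c p q, ¬ D s(q, p) s(p, z) := by
    intro z hz h
    have hz := mem_outside.1 hz
    have h' := htrans hqa h
    have := hm h'
    have haz : a = z := by clear hH hadj hext; grind only
    exact hno z (haz ▸ h')
  have hI : ∀ z ∈ outside c p q, ∀ w ∈ outside c p q, D s(c, z) s(c, w) →
      ∀ y ∈ outside c p q, D s(q, y) s(q, p) → y = w ∧ D s(q, w) s(c, w) := by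
    intro z hz w hw h y hy hqy
    rw [mem_outside] at hz hw hy
    have h' : D s(q, y) s(c, w) := (free h hqy).resolve_left fun h => by
      have := hm h
      clear hH hadj hext
      grind only
    have := hm h'
    have hyw : y = w := by clear hH hadj hext; grind only
    exact ⟨hyw, hyw ▸ h'⟩
  have hIV : ∀ z ∈ outside c p q, ∀ w ∈ outside c p q, D s(q, z) s(c, z) → D s(q, w) s(c, w) →
      z = w := by
    intro z hz w hw h h'
    rw [mem_outside] at hz hw
    clear hH hadj hext
    rcases free h h' with h | h <;> have := hm h <;> grind only
  by_cases hcenter : ∃ z ∈ outside c p q, z ≠ a ∧ D s(c, z) s(c, a)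
  · obtain ⟨b, hb, hba, h⟩ := hcenter
    have hqc := (hI b hb a ha h a ha hqa).2
    refine ncard_edgeSet_of_fan_center hH hcp hcq hpq hadj hn ha fun u v huv => ?_
    rcases rel_cases hcp hcq hpq hmeets hext huv with hu | hv | ⟨z, hz, hcase⟩
    · exact Or.inl hu
    · exact Or.inr (Or.inl hv)
    rcases hcase with ⟨w, hw, hzw, rfl, rfl⟩ | ⟨rfl, rfl⟩ | ⟨rfl, rfl⟩ | ⟨rfl, rfl⟩ | ⟨rfl, rfl⟩ |
      ⟨rfl, rfl⟩
    · obtain ⟨rfl, -⟩ := hI z hz w hw huv a ha hqa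
      exact Or.inr (Or.inr (Or.inl ⟨z, hz, hzw, rfl, rfl⟩))
    · exact (hII z hz huv).elim
    · exact (hIII z hz huv).elim
    · simp [hIV z hz a ha huv hqc]
    · simp [(hI b hb a ha h z hz huv).1]
    · exact (hno z huv).elim
  · obtain ⟨k, hk, hIVk⟩ : ∃ k ∈ outside c p q, ∀ z ∈ outside c p q, D s(q, z) s(c, z) →
        z = k := by
      by_cases hex : ∃ k ∈ outside c p q, D s(q, k) s(c, k)
      · obtain ⟨k, hk, h⟩ := hex
        exact ⟨k, hk, fun z hz h' => hIV z hz k hk h' h⟩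
      · exact ⟨a, ha, fun z hz h => (hex ⟨z, hz, h⟩).elim⟩
    refine ncard_edgeSet_of_fan_end hH hcp hcq hpq hadj hn hk fun u v huv => ?_
    rcases rel_cases hcp hcq hpq hmeets hext huv with hu | hv | ⟨z, hz, hcase⟩
    · exact Or.inl hu
    · exact Or.inr (Or.inl hv)
    rcases hcase with ⟨w, hw, hzw, rfl, rfl⟩ | ⟨rfl, rfl⟩ | ⟨rfl, rfl⟩ | ⟨rfl, rfl⟩ | ⟨rfl, rfl⟩ |
      ⟨rfl, rfl⟩
    · obtain ⟨rfl, -⟩ := hI z hz w hw huv a ha hqa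
      exact (hcenter ⟨z, hz, hzw, huv⟩).elim
    · exact (hII z hz huv).elim
    · exact (hIII z hz huv).elim
    · simp [hIVk z hz huv]
    · exact Or.inr (Or.inr (Or.inl ⟨z, hz, rfl, rfl⟩))
    · exact (hno z huv).elim

theorem ncard_edgeSet_of_forall_not (hn : 5 ≤ n) (hend : ∀ z ∈ outside c p q, ¬ D s(q, z) s(q, p))
    (hstart : ∀ z ∈ outside c p q, ¬ D s(q, p) s(p, z)) (hno : ∀ z, ¬ D s(q, z) s(p, z)) :
    H.edgeSet.ncard = (n + 2) * (n - 1) / 2 := by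
  have hm := @rel_mk n D hmeets
  have htrans := @rel_trans n D free hmeets
  have hII : ∀ z ∈ outside c p q, ∀ w ∈ outside c p q, D s(c, z) s(p, z) → D s(c, w) s(p, w) →
      z = w := by
    intro z hz w hw h h'
    rw [mem_outside] at hz hw
    clear hH hadj hext
    rcases free h h' with h | h <;> have := hm h <;> grind only
  have hIV : ∀ z ∈ outside c p q, ∀ w ∈ outside c p q, D s(q, z) s(c, z) → D s(q, w) s(c, w) →
      z = w := by
    intro z hz w hw h h'
    rw [mem_outside] at hz hw
    clear hH hadj hext
    rcases free h h' with h | h <;> have := hm h <;> grind only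
  have hcard : 1 < (outside c p q).card := by
    rw [card_outside hcp hcq hpq]
    omega
  obtain ⟨a, ha, b, hb, hab, haII, hbIV⟩ : ∃ a ∈ outside c p q, ∃ b ∈ outside c p q, a ≠ b ∧
      (∀ z ∈ outside c p q, D s(c, z) s(p, z) → z = a) ∧
      (∀ z ∈ outside c p q, D s(q, z) s(c, z) → z = b) := by
    by_cases hexa : ∃ a ∈ outside c p q, D s(c, a) s(p, a)
    · obtain ⟨a, ha, h⟩ := hexa
      by_cases hexb : ∃ b ∈ outside c p q, D s(q, b) s(c, b)
      · obtain ⟨b, hb, h'⟩ := hexb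
        refine ⟨a, ha, b, hb, ?_, fun z hz hz' => hII z hz a ha hz' h,
          fun z hz hz' => hIV z hz b hb hz' h'⟩
        rintro rfl
        exact hno a (htrans h' h)
      · obtain ⟨b, hb, hba⟩ := Finset.exists_mem_ne hcard a
        exact ⟨a, ha, b, hb, hba.symm, fun z hz hz' => hII z hz a ha hz' h,
          fun z hz hz' => (hexb ⟨z, hz, hz'⟩).elim⟩
    · obtain ⟨b, hb, hbIV⟩ : ∃ b ∈ outside c p q, ∀ z ∈ outside c p q, D s(q, z) s(c, z) →
          z = b := by
        by_cases hexb : ∃ b ∈ outside c p q, D s(q, b) s(c, b)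
        · obtain ⟨b, hb, h'⟩ := hexb
          exact ⟨b, hb, fun z hz hz' => hIV z hz b hb hz' h'⟩
        · obtain ⟨b, hb⟩ := Finset.card_pos.1 (zero_lt_one.trans hcard)
          exact ⟨b, hb, fun z hz hz' => (hexb ⟨z, hz, hz'⟩).elim⟩
      obtain ⟨a, ha, hab⟩ := Finset.exists_mem_ne hcard b
      exact ⟨a, ha, b, hb, hab, fun z hz hz' => (hexa ⟨z, hz, hz'⟩).elim, hbIV⟩
  refine ncard_edgeSet_of_star hH hcp hcq hpq hadj hn ha hb hab fun u v huv => ?_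
  rcases rel_cases hcp hcq hpq hmeets hext huv with hu | hv | ⟨z, hz, hcase⟩
  · exact Or.inl hu
  · exact Or.inr (Or.inl hv)
  rcases hcase with ⟨w, hw, hzw, rfl, rfl⟩ | ⟨rfl, rfl⟩ | ⟨rfl, rfl⟩ | ⟨rfl, rfl⟩ | ⟨rfl, rfl⟩ |
    ⟨rfl, rfl⟩
  · exact Or.inr (Or.inr (Or.inl ⟨z, hz, w, hw, hzw, rfl, rfl⟩))
  · simp [haII z hz huv]
  · exact (hstart z hz huv).elim
  · simp [hbIV z hz huv]
  · exact (hend z hz huv).elim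
  · exact (hno z huv).elim

/-- The main case analysis: `s(c, p)` and `s(c, q)` are the extremal elements of the interval order
`D` underlying the maximal subgraph `H`. -/
theorem ncard_edgeSet_of_extremal (hn : 5 ≤ n) :
    H.edgeSet.ncard = (n + 2) * (n - 1) / 2 ∨ H.edgeSet.ncard = 4 * (n - 1) ∨
      H.edgeSet.ncard = 5 * (n - 2) := by
  have hm := @rel_mk n D hmeets
  have hadj' : ∀ u v, H.Adj u v → D v.1 u.1 ∨ D u.1 v.1 := fun u v h => (hadj u v h).symm
  have free' : TwoPlusTwoFree fun u v => D v u := fun u v u' v' h h' => (free h h').symm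
  have hmeets' : ∀ ⦃u v⦄, D v u → u.Meets v := fun u v h => (hmeets h).symm
  have hext' : ∀ ⦃u v⦄, D v u → D v s(c, q) ∧ D s(c, p) u := fun u v h => (hext h).symm
  have houtside : outside c q p = outside c p q := by
    ext z
    simp only [mem_outside, and_comm (a := z ≠ q)]
  by_cases hopp : ∃ k ∈ outside c p q, D s(q, k) s(p, k)
  · obtain ⟨k, hk, hqk⟩ := hopp
    by_cases h1 : ∃ z ∈ outside c p q, D s(c, z) s(c, k)
    · obtain ⟨z, hz, h⟩ := h1
      exact Or.inr (Or.inr (ncard_edgeSet_of_opposite_of_center hH hcp hcq hpq hadj free hmeets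
        hext hn hk hz hqk h))
    by_cases h2 : ∃ z ∈ outside c p q, D s(c, k) s(c, z)
    · obtain ⟨z, hz, h⟩ := h2
      exact Or.inr (Or.inr (ncard_edgeSet_of_opposite_of_center hH hcq hcp hpq.symm hadj' free'
        hmeets' hext' hn (houtside ▸ hk) (houtside ▸ hz) hqk h))
    by_cases h3 : ∃ z ∈ outside c p q, z ≠ k ∧ D s(q, z) s(q, p)
    · obtain ⟨z, hz, hzk, h⟩ := h3
      exact Or.inr (Or.inr (ncard_edgeSet_of_opposite_of_end hH hcp hcq hpq hadj free hmeets
        hext hn hk hz hzk hqk h))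
    by_cases h4 : ∃ z ∈ outside c p q, z ≠ k ∧ D s(q, p) s(p, z)
    · obtain ⟨z, hz, hzk, h⟩ := h4
      exact Or.inr (Or.inr (ncard_edgeSet_of_opposite_of_end hH hcq hcp hpq.symm hadj' free'
        hmeets' hext' hn (houtside ▸ hk) (houtside ▸ hz) hzk hqk (Sym2.eq_swap (a := p) ▸ h)))
    refine Or.inr (Or.inl (ncard_edgeSet_of_single hH hcp hcq hpq hadj hn hk fun u v h => ?_))
    rcases rel_cases hcp hcq hpq hmeets hext h with hu | hv | ⟨z, hz, hcase⟩
    · exact Or.inl hu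
    · exact Or.inr (Or.inl hv)
    have hk' := mem_outside.1 hk
    have hz' := mem_outside.1 hz
    clear hH hadj hadj' hext hext' houtside free' hmeets'
    rcases hcase with ⟨w, hw, hzw, rfl, rfl⟩ | ⟨rfl, rfl⟩ | ⟨rfl, rfl⟩ | ⟨rfl, rfl⟩ |
      ⟨rfl, rfl⟩ | ⟨rfl, rfl⟩
    · exfalso
      have hw' := mem_outside.1 hw
      have hor : z = k ∨ w = k := by
        clear h1 h2 h3 h4
        rcases free h hqk with h | h <;> have := hm h <;> grind only
      rcases hor with rfl | rfl
      · exact h2 ⟨w, hw, h⟩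
      · exact h1 ⟨z, hz, h⟩
    · have hzk : z = k := by
        clear h1 h2 h3 h4
        rcases free h hqk with h | h <;> have := hm h <;> grind only
      simp [hzk]
    · have hzk : z = k := by_contra fun hzk => h4 ⟨z, hz, hzk, h⟩
      simp [hzk]
    · have hzk : z = k := by
        clear h1 h2 h3 h4
        rcases free h hqk with h | h <;> have := hm h <;> grind only
      simp [hzk]
    · have hzk : z = k := by_contra fun hzk => h3 ⟨z, hz, hzk, h⟩
      simp [hzk]
    · have hzk : z = k := by
        clear h1 h2 h3 h4
        rcases free h hqk with h | h <;> have := hm h <;> grind only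
      simp [hzk]
  · have hno : ∀ z, ¬ D s(q, z) s(p, z) := by
      intro z h
      have h' := hm h
      have hne := hm (hext h).1
      refine hopp ⟨z, mem_outside.2 ?_, h⟩
      clear hH hadj hext hadj' hext' hopp
      grind only
    by_cases h1 : ∃ z ∈ outside c p q, D s(q, z) s(q, p)
    · obtain ⟨z, hz, h⟩ := h1
      exact Or.inr (Or.inr (ncard_edgeSet_of_end hH hcp hcq hpq hadj free hmeets hext hn hz h hno))
    by_cases h2 : ∃ z ∈ outside c p q, D s(q, p) s(p, z)
    · obtain ⟨z, hz, h⟩ := h2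
      exact Or.inr (Or.inr (ncard_edgeSet_of_end hH hcq hcp hpq.symm hadj' free' hmeets' hext' hn
        (houtside ▸ hz) (Sym2.eq_swap (a := p) ▸ h) hno))
    exact Or.inl (ncard_edgeSet_of_forall_not hH hcp hcq hpq hadj free hmeets hext hn
      (fun z hz h => h1 ⟨z, hz, h⟩) (fun z hz h => h2 ⟨z, hz, h⟩) hno)

end SimpleGraph

/-- For `n ≥ 5`, every maximal interval-order subgraph of `L(K_n)` has exactly
`(n+2)(n−1)/2`, `4(n−1)`, or `5(n−2)` edges. -/
theorem card_edges_maximal_intervalOrder_subgraph_lineGraph_complete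
    (n : ℕ) (hn : 5 ≤ n) (H : SimpleGraph (⊤ : SimpleGraph (Fin n)).edgeSet)
    (hH : Maximal (fun H' : SimpleGraph (⊤ : SimpleGraph (Fin n)).edgeSet =>
      H' ≤ (⊤ : SimpleGraph (Fin n)).lineGraph ∧ H'.IsIntervalOrderGraph) H) :
    H.edgeSet.ncard = (n + 2) * (n - 1) / 2 ∨
    H.edgeSet.ncard = 4 * (n - 1) ∨
    H.edgeSet.ncard = 5 * (n - 2) := by
  obtain ⟨D₀, free₀, hadj₀, hext₀⟩ := hH.prop.2.exists_rel
  let D : Sym2 (Fin n) → Sym2 (Fin n) → Prop := fun e f =>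
    ∃ he hf, D₀ ⟨e, he⟩ ⟨f, hf⟩
  have hadj : ∀ u v, H.Adj u v → D u.1 v.1 ∨ D v.1 u.1 := fun u v h =>
    ((hadj₀ u v).1 h).imp (fun h => ⟨u.2, v.2, h⟩) fun h => ⟨v.2, u.2, h⟩
  have hmeets : ∀ ⦃u v⦄, D u v → u.Meets v := fun u v ⟨hu, hv, h⟩ =>
    (SimpleGraph.lineGraph_top_adj_iff ⟨u, hu⟩ ⟨v, hv⟩).1
      (hH.prop.1 ((hadj₀ _ _).2 (Or.inl h)))
  have free : SimpleGraph.TwoPlusTwoFree D := fun u v u' v' ⟨hu, hv, h⟩ ⟨hu', hv', h'⟩ =>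
    (free₀ h h').imp (fun h => ⟨hu, hv', h⟩) fun h => ⟨hu', hv, h⟩
  by_cases hne : ∃ u v, D u v
  · obtain ⟨u, v, hu, hv, huv⟩ := hne
    obtain ⟨⟨x, hx⟩, ⟨y, hy⟩, hxy⟩ := hext₀ ⟨u, hu⟩ ⟨v, hv⟩ huv
    have hext : ∀ ⦃u v⦄, D u v → D x v ∧ D u y := fun u v ⟨hu, hv, h⟩ =>
      ⟨⟨hx, hv, (hxy _ _ h).1⟩, hu, hy, (hxy _ _ h).2⟩
    have hmxy : x.Meets y := hmeets (hext (hext ⟨hu, hv, huv⟩).1).2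
    clear_value D
    clear hxy hy hx
    induction y with | _ a b
    have hab : a ≠ b := hmxy.2.1
    obtain ⟨z, hza, hzb, rfl | rfl⟩ := hmxy.exists_eq
    · exact SimpleGraph.ncard_edgeSet_of_extremal hH hza.symm hab hzb hadj free hmeets hext hn
    · rw [Sym2.eq_swap (a := a)] at hext
      exact SimpleGraph.ncard_edgeSet_of_extremal hH hzb.symm hab.symm hza hadj free hmeets hext hn
  · refine Or.inr (Or.inl (SimpleGraph.ncard_edgeSet_of_single (c := ⟨0, by omega⟩)
      (p := ⟨1, by omega⟩) (q := ⟨2, by omega⟩) (k := ⟨3, by omega⟩) hH (by simp) (by simp)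
      (by simp) hadj hn (by simp [SimpleGraph.mem_outside]) fun u v h => (hne ⟨u, v, h⟩).elim))
end
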